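/- arXiv:1803.05800 — 3 statements merged into one kernel-verified Lean document; each statement's English description precedes it below -/
import Mathlib

section
/- There is a constant c > 0 such that for all sufficiently large X, the number of isomorphism classes of imaginary quadratic fields k with |Disc(k)| < X and rank_5 Cl(k) ≥ 3 is at least c·X^(1/11)/log X. -/
open NumberField

/-- The square root of a negative integer `F` in the upper half plane. -/
noncomputable def imSqrt (F : ℤ) : ℂ := (Real.sqrt (-F) : ℂ) * Complex.I

lemma imSqrt_sq {F : ℤ} (hF : F < 0) : imSqrt F ^ 2 = F := by
  have h : ((Real.sqrt (-F) : ℝ) : ℂ) ^ 2 = ((-F : ℝ) : ℂ) := by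
    rw [← Complex.ofReal_pow, Real.sq_sqrt]
    have : (F : ℝ) < 0 := by exact_mod_cast hF
    linarith
  rw [imSqrt, mul_pow, h, Complex.I_sq]
  push_cast
  ring

lemma imSqrt_re (F : ℤ) : (imSqrt F).re = 0 := by simp [imSqrt]

lemma imSqrt_im_pos {F : ℤ} (hF : F < 0) : 0 < (imSqrt F).im := by
  have : (F : ℝ) < 0 := by exact_mod_cast hF
  simpa [imSqrt] using this

lemma conj_imSqrt (F : ℤ) : (starRingEnd ℂ) (imSqrt F) = -imSqrt F := by
  simp [imSqrt]

/-- The imaginary quadratic field `ℚ(√F)` inside `ℂ`. -/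
noncomputable def imQuad (F : ℤ) : Subfield ℂ := Subfield.closure {imSqrt F}

lemma imSqrt_mem (F : ℤ) : imSqrt F ∈ imQuad F := Subfield.subset_closure rfl

lemma ratCast_mem_imQuad (F : ℤ) (a : ℚ) : (a : ℂ) ∈ imQuad F :=
  SubfieldClass.ratCast_mem _ a

lemma mem_imQuad_iff {F : ℤ} (hF : F < 0) {z : ℂ} :
    z ∈ imQuad F ↔ ∃ a b : ℚ, z = a + b * imSqrt F := by
  have hsq := imSqrt_sq hF
  constructor
  · intro hz
    induction hz using Subfield.closure_induction with
    | mem x hx => exact ⟨0, 1, by simpa using hx⟩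
    | one => exact ⟨1, 0, by simp⟩
    | add x y _ _ hx hy =>
      obtain ⟨a, b, rfl⟩ := hx
      obtain ⟨c, d, rfl⟩ := hy
      exact ⟨a + c, b + d, by push_cast; ring⟩
    | neg x _ hx =>
      obtain ⟨a, b, rfl⟩ := hx
      exact ⟨-a, -b, by push_cast; ring⟩
    | inv x _ hx =>
      obtain ⟨a, b, rfl⟩ := hx
      by_cases h0 : (a : ℂ) + b * imSqrt F = 0
      · exact ⟨0, 0, by simp [h0]⟩
      · have hq : a ^ 2 - F * b ^ 2 ≠ 0 := by
          intro h
          have hF' : (F : ℚ) < 0 := by exact_mod_cast hF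
          have ha : a = 0 := by nlinarith [sq_nonneg a, sq_nonneg b]
          have hb : b = 0 := by
            rw [ha] at h
            have : b ^ 2 = 0 := by
              rcases mul_eq_zero.1 (show (F : ℚ) * b ^ 2 = 0 by linarith) with h | h
              · exact absurd h hF'.ne
              · exact h
            simpa using this
          simp [ha, hb] at h0
        have hq' : (a : ℂ) ^ 2 - F * b ^ 2 ≠ 0 := by exact_mod_cast hq
        refine ⟨a / (a ^ 2 - F * b ^ 2), -b / (a ^ 2 - F * b ^ 2), ?_⟩
        apply inv_eq_of_mul_eq_one_right
        have e : ((a : ℂ) + b * imSqrt F) * (a - b * imSqrt F) = a ^ 2 - F * b ^ 2 := by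
          linear_combination (-(b : ℂ) ^ 2) * hsq
        push_cast
        rw [← div_self hq', ← e]
        ring
    | mul x y _ _ hx hy =>
      obtain ⟨a, b, rfl⟩ := hx
      obtain ⟨c, d, rfl⟩ := hy
      refine ⟨a * c + F * b * d, a * d + b * c, ?_⟩
      push_cast
      linear_combination (b * d : ℂ) * hsq
  · rintro ⟨a, b, rfl⟩
    exact add_mem (ratCast_mem_imQuad F a) (mul_mem (ratCast_mem_imQuad F b) (imSqrt_mem F))

lemma rat_pair_eq {F : ℤ} (hF : F < 0) {a b c d : ℚ}
    (h : (a : ℂ) + b * imSqrt F = c + d * imSqrt F) : a = c ∧ b = d := by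
  have hre := congrArg Complex.re h
  have him := congrArg Complex.im h
  have hpos := (imSqrt_im_pos hF).ne'
  simp [imSqrt_re] at hre him
  exact ⟨hre, him.resolve_right hpos⟩

/-- The generator of `ℚ(√F)`. -/
noncomputable def imGen (F : ℤ) : imQuad F := ⟨imSqrt F, imSqrt_mem F⟩

lemma imGen_sq {F : ℤ} (hF : F < 0) : imGen F ^ 2 = F := by
  apply Subtype.ext
  simpa [imGen] using imSqrt_sq hF

lemma exists_eq_imGen {F : ℤ} (hF : F < 0) (z : imQuad F) :
    ∃ a b : ℚ, z = a + b * imGen F := by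
  obtain ⟨a, b, h⟩ := (mem_imQuad_iff hF).1 z.2
  exact ⟨a, b, Subtype.ext (by simpa [imGen] using h)⟩

lemma linearIndependent_imGen {F : ℤ} (hF : F < 0) :
    LinearIndependent ℚ ![(1 : imQuad F), imGen F] := by
  rw [LinearIndependent.pair_iff]
  intro s t h
  have h' := congrArg (Subtype.val : imQuad F → ℂ) h
  have : (s : ℂ) + t * imSqrt F = (0 : ℚ) + (0 : ℚ) * imSqrt F := by
    simpa [imGen, Rat.smul_def] using h'
  simpa using rat_pair_eq hF this

/-- The basis `1, √F` of `ℚ(√F)`. -/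
noncomputable def imBasis {F : ℤ} (hF : F < 0) : Module.Basis (Fin 2) ℚ (imQuad F) :=
  Module.Basis.mk (linearIndependent_imGen hF) (by
    rintro z -
    obtain ⟨a, b, rfl⟩ := exists_eq_imGen hF z
    have h1 : (a : imQuad F) + b * imGen F = a • (1 : imQuad F) + b • imGen F := by
      simp [Rat.smul_def]
    rw [h1]
    refine add_mem (Submodule.smul_mem _ _ (Submodule.subset_span ⟨0, rfl⟩))
      (Submodule.smul_mem _ _ (Submodule.subset_span ⟨1, rfl⟩)))

lemma finrank_imQuad {F : ℤ} (hF : F < 0) : Module.finrank ℚ (imQuad F) = 2 := by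
  simpa using Module.finrank_eq_card_basis (imBasis hF)

lemma numberField_imQuad {F : ℤ} (hF : F < 0) : NumberField (imQuad F) where
  to_finiteDimensional := Module.Basis.finiteDimensional_of_finite (imBasis hF)

lemma exists_im_ne_zero {F : ℤ} (hF : F < 0) (φ : imQuad F →+* ℂ) :
    ∃ a, (φ a).im ≠ 0 := by
  refine ⟨imGen F, fun h => ?_⟩
  have h2 : (φ (imGen F)) ^ 2 = F := by rw [← map_pow, imGen_sq hF, map_intCast]
  have h3 := congrArg Complex.re h2
  have hF' : (F : ℝ) < 0 := by exact_mod_cast hF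
  simp [pow_two, h] at h3
  nlinarith [mul_self_nonneg (φ (imGen F)).re]

lemma imQuad_le_of_ringHom {F G : ℤ} (hF : F < 0) (φ : imQuad F →+* imQuad G) :
    imQuad F ≤ imQuad G := by
  have h2 : ((φ (imGen F) : imQuad G) : ℂ) ^ 2 = imSqrt F ^ 2 := by
    rw [imSqrt_sq hF]
    have : (φ (imGen F)) ^ 2 = F := by rw [← map_pow, imGen_sq hF, map_intCast]
    exact_mod_cast congrArg (Subtype.val : imQuad G → ℂ) this
  refine Subfield.closure_le.2 ?_
  rw [Set.singleton_subset_iff]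
  rcases sq_eq_sq_iff_eq_or_eq_neg.1 h2 with h | h
  · rw [← h]; exact (φ (imGen F)).2
  · rw [← neg_eq_iff_eq_neg.2 h]; exact neg_mem (φ (imGen F)).2

/-- Isomorphic imaginary quadratic subfields of `ℂ` coincide. -/
lemma imQuad_eq_of_ringEquiv {F G : ℤ} (hF : F < 0) (hG : G < 0)
    (φ : imQuad F ≃+* imQuad G) : imQuad F = imQuad G :=
  le_antisymm (imQuad_le_of_ringHom hF φ.toRingHom) (imQuad_le_of_ringHom hG φ.symm.toRingHom)

lemma isSquare_of_imQuad_eq {F G : ℤ} (hF : F < 0) (hG : G < 0) (h : imQuad F = imQuad G) :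
    IsSquare (F * G) := by
  have hm : imSqrt F ∈ imQuad G := h ▸ imSqrt_mem F
  obtain ⟨a, b, hab⟩ := (mem_imQuad_iff hG).1 hm
  have ha : a = 0 := by
    have := congrArg Complex.re hab
    have h0 : (0 : ℝ) = a := by simpa [imSqrt_re] using this
    exact_mod_cast h0.symm
  have h2 : (F : ℂ) = b ^ 2 * G := by
    rw [← imSqrt_sq hF, ← imSqrt_sq hG, hab, ha]
    push_cast
    ring
  have h3 : (F : ℚ) = b ^ 2 * G := by exact_mod_cast h2
  rw [← Rat.isSquare_intCast_iff]
  exact ⟨b * G, by push_cast; rw [h3]; ring⟩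

lemma trace_imGen {F : ℤ} (hF : F < 0) : Algebra.trace ℚ (imQuad F) (imGen F) = 0 := by
  have e0 : imGen F = (imBasis hF) 1 := by simp [imBasis]
  have e1 : (1 : imQuad F) = (imBasis hF) 0 := by simp [imBasis]
  rw [Algebra.trace_eq_matrix_trace (imBasis hF), Matrix.trace_fin_two,
    Algebra.leftMulMatrix_eq_repr_mul, Algebra.leftMulMatrix_eq_repr_mul, ← e0, ← e1, mul_one,
    ← pow_two, imGen_sq hF]
  have e2 : (F : imQuad F) = (F : ℚ) • (imBasis hF) 0 := by
    rw [← e1]; simp [Rat.smul_def]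
  rw [e2, e0]
  simp

/-- The generator of `ℚ(√F)` as an algebraic integer. -/
noncomputable def imInt {F : ℤ} (hF : F < 0) : 𝓞 (imQuad F) :=
  ⟨imGen F, ⟨Polynomial.X ^ 2 - Polynomial.C F, Polynomial.monic_X_pow_sub_C _ two_ne_zero, by
    rw [Polynomial.eval₂_sub, Polynomial.eval₂_X_pow, Polynomial.eval₂_C, imGen_sq hF]
    simp⟩⟩

lemma coe_imInt {F : ℤ} (hF : F < 0) : (imInt hF : imQuad F) = imGen F := rfl

lemma imInt_sq {F : ℤ} (hF : F < 0) : imInt hF ^ 2 = F :=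
  RingOfIntegers.ext (by
    change algebraMap (𝓞 (imQuad F)) (imQuad F) (imInt hF ^ 2) = algebraMap _ _ (F : 𝓞 (imQuad F))
    rw [map_pow, map_intCast]
    exact imGen_sq hF)

lemma abs_discr_imQuad_le {F : ℤ} (hF : F < 0) [NumberField (imQuad F)] :
    |discr (imQuad F)| ≤ 4 * |F| := by
  let ω := imInt hF
  have hω : ω ^ 2 = F := imInt_sq hF
  have hcard : Fintype.card (Module.Free.ChooseBasisIndex ℤ (𝓞 (imQuad F))) =
      Fintype.card (Fin 2) := by
    rw [← Module.finrank_eq_card_chooseBasisIndex, RingOfIntegers.rank, finrank_imQuad hF]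
    simp
  let b := (RingOfIntegers.basis (imQuad F)).reindex (Fintype.equivOfCardEq hcard)
  have hb : Algebra.discr ℤ b = discr (imQuad F) := discr_eq_discr _ b
  have hdet := Algebra.discr_of_matrix_vecMul b (b.toMatrix ![1, ω])
  have hv : Matrix.vecMul (b : Fin 2 → 𝓞 (imQuad F))
      ((b.toMatrix ![1, ω]).map (algebraMap ℤ (𝓞 (imQuad F)))) = ![1, ω] := by
    funext j
    rw [← b.sum_toMatrix_smul_self ![1, ω] j]
    simp only [Matrix.vecMul, dotProduct, Matrix.map_apply]
    exact Finset.sum_congr rfl fun i _ => by rw [Algebra.smul_def, mul_comm]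
  have ht1 : Algebra.trace ℤ (𝓞 (imQuad F)) 1 = 2 := by
    have := Algebra.trace_algebraMap (R := ℤ) (S := 𝓞 (imQuad F)) 1
    rw [map_one, RingOfIntegers.rank, finrank_imQuad hF] at this
    simpa using this
  have htω : Algebra.trace ℤ (𝓞 (imQuad F)) ω = 0 := by
    have := Algebra.coe_trace_int ω
    rw [coe_imInt, trace_imGen hF] at this
    exact_mod_cast this
  have htF : Algebra.trace ℤ (𝓞 (imQuad F)) (ω * ω) = 2 * F := by
    rw [← pow_two, hω]
    have := Algebra.trace_algebraMap (R := ℤ) (S := 𝓞 (imQuad F)) F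
    rw [RingOfIntegers.rank, finrank_imQuad hF] at this
    simpa using this
  have hd : Algebra.discr ℤ ![1, ω] = 4 * F := by
    rw [Algebra.discr_def, Matrix.det_fin_two]
    simp [Algebra.traceMatrix_apply, Algebra.traceForm_apply, ht1, htω, htF]
    ring
  rw [hv, hd, hb] at hdet
  have hne : (b.toMatrix ![1, ω]).det ^ 2 ≠ 0 := by
    intro h
    rw [h, zero_mul] at hdet
    omega
  have h1 : 1 ≤ (b.toMatrix ![1, ω]).det ^ 2 := by
    have := sq_nonneg (b.toMatrix ![1, ω]).det
    omega
  calc |discr (imQuad F)| ≤ (b.toMatrix ![1, ω]).det ^ 2 * |discr (imQuad F)| :=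
        le_mul_of_one_le_left (abs_nonneg _) h1
    _ = |4 * F| := by rw [hdet, abs_mul, abs_pow, sq_abs]
    _ = 4 * |F| := by rw [abs_mul]; norm_num

lemma int_of_isIntegral_ratCast {q : ℚ} (h : IsIntegral ℤ (q : ℂ)) : ∃ t : ℤ, (t : ℚ) = q := by
  have h1 : IsIntegral ℤ q :=
    (isIntegral_algHom_iff (algebraMap ℚ ℂ).toIntAlgHom (algebraMap ℚ ℂ).injective).1 h
  simpa using IsIntegrallyClosed.isIntegral_iff.1 h1

lemma isIntegral_conj {z : ℂ} (h : IsIntegral ℤ z) : IsIntegral ℤ ((starRingEnd ℂ) z) :=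
  h.map (starRingEnd ℂ).toIntAlgHom

lemma isIntegral_imSqrt {F : ℤ} (hF : F < 0) : IsIntegral ℤ (imSqrt F) :=
  ⟨Polynomial.X ^ 2 - Polynomial.C F, Polynomial.monic_X_pow_sub_C _ two_ne_zero, by
    rw [Polynomial.eval₂_sub, Polynomial.eval₂_X_pow, Polynomial.eval₂_C, imSqrt_sq hF]
    simp⟩

lemma integral_coords {F : ℤ} (hF : F < 0) {a b : ℚ}
    (h : IsIntegral ℤ ((a : ℂ) + b * imSqrt F)) :
    (∃ t : ℤ, (t : ℚ) = 2 * a) ∧ (∃ u : ℤ, (u : ℚ) = 2 * b * F) ∧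
      ∃ n : ℤ, (n : ℚ) = a ^ 2 - F * b ^ 2 := by
  have hsq := imSqrt_sq hF
  have hc := isIntegral_conj h
  have hω := isIntegral_imSqrt hF
  simp only [map_add, map_mul, conj_imSqrt, map_ratCast] at hc
  refine ⟨int_of_isIntegral_ratCast ?_, int_of_isIntegral_ratCast ?_, int_of_isIntegral_ratCast ?_⟩
  · have e : ((2 * a : ℚ) : ℂ) = (a + b * imSqrt F) + (a + b * -imSqrt F) := by
      push_cast
      ring
    exact e ▸ h.add hc
  · have e : ((2 * b * F : ℚ) : ℂ) =
        ((a + b * imSqrt F) - (a + b * -imSqrt F)) * imSqrt F := by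
      push_cast
      linear_combination (-2 * b : ℂ) * hsq
    exact e ▸ (h.sub hc).mul hω
  · have e : ((a ^ 2 - F * b ^ 2 : ℚ) : ℂ) =
        (a + b * imSqrt F) * (a + b * -imSqrt F) := by
      push_cast
      linear_combination (b ^ 2 : ℂ) * hsq
    exact e ▸ h.mul hc

lemma coe_isIntegral {F : ℤ} (z : 𝓞 (imQuad F)) : IsIntegral ℤ (((z : imQuad F) : ℂ)) :=
  (RingOfIntegers.isIntegral_coe z).map (imQuad F).subtype.toIntAlgHom

/-- The ring embedding of the integers of `ℚ(√F)` into `ℂ`. -/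
noncomputable def imEmb (F : ℤ) : 𝓞 (imQuad F) →+* ℂ :=
  (imQuad F).subtype.comp (algebraMap (𝓞 (imQuad F)) (imQuad F))

lemma imEmb_injective (F : ℤ) : Function.Injective (imEmb F) :=
  (imQuad F).subtype.injective.comp RingOfIntegers.coe_injective

lemma imEmb_imInt {F : ℤ} (hF : F < 0) : imEmb F (imInt hF) = imSqrt F := rfl

lemma exists_imEmb_eq {F : ℤ} (hF : F < 0) (z : 𝓞 (imQuad F)) :
    ∃ a b : ℚ, imEmb F z = a + b * imSqrt F ∧ (∃ t : ℤ, (t : ℚ) = 2 * a) ∧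
      (∃ u : ℤ, (u : ℚ) = 2 * b * F) ∧ ∃ n : ℤ, (n : ℚ) = a ^ 2 - F * b ^ 2 := by
  obtain ⟨a, b, h⟩ := (mem_imQuad_iff hF).1 (z : imQuad F).2
  exact ⟨a, b, h, integral_coords hF (h ▸ coe_isIntegral z)⟩

lemma exists_two_mul_eq {F : ℤ} (hF : F < 0) (z : 𝓞 (imQuad F)) :
    ∃ t u : ℤ, 2 * F * z = t + u * imInt hF := by
  obtain ⟨a, b, h, ⟨t, ht⟩, ⟨u, hu⟩, -⟩ := exists_imEmb_eq hF z
  refine ⟨F * t, u, imEmb_injective F ?_⟩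
  have ht' : (t : ℂ) = 2 * a := by exact_mod_cast congrArg (Rat.cast : ℚ → ℂ) ht
  have hu' : (u : ℂ) = 2 * b * F := by exact_mod_cast congrArg (Rat.cast : ℚ → ℂ) hu
  simp only [map_add, map_mul, map_intCast, map_ofNat, imEmb_imInt, h]
  push_cast
  rw [ht', hu']
  ring

lemma unit_pow_twelve {F : ℤ} (hF : F < 0) (u : (𝓞 (imQuad F))ˣ) : u ^ 12 = 1 := by
  obtain ⟨a, b, h, ⟨t, ht⟩, -, ⟨n, hn⟩⟩ := exists_imEmb_eq hF (u : 𝓞 (imQuad F))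
  obtain ⟨a', b', h', -, -, ⟨n', hn'⟩⟩ :=
    exists_imEmb_eq hF ((u⁻¹ : (𝓞 (imQuad F))ˣ) : 𝓞 (imQuad F))
  have hsq := imSqrt_sq hF
  have hFq : (F : ℚ) < 0 := by exact_mod_cast hF
  have hmul : (a + b * imSqrt F) * (a' + b' * imSqrt F) = 1 := by
    rw [← h, ← h', ← map_mul, ← Units.val_mul, mul_inv_cancel, Units.val_one, map_one]
  have hmul' : ((a * a' + b * b' * F : ℚ) : ℂ) + ((a * b' + b * a' : ℚ) : ℂ) * imSqrt F
      = (1 : ℚ) + (0 : ℚ) * imSqrt F := by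
    push_cast
    linear_combination hmul - (b * b' : ℂ) * hsq
  obtain ⟨e1, e2⟩ := rat_pair_eq hF hmul'
  have hnn : n * n' = 1 := by
    have : (n : ℚ) * n' = 1 := by
      rw [hn, hn']
      linear_combination (a * a' + b * b' * F + 1) * e1 - F * (a * b' + b * a') * e2
    exact_mod_cast this
  have hn0 : 0 ≤ n := by
    have : (0 : ℚ) ≤ n := by rw [hn]; nlinarith [sq_nonneg a, sq_nonneg b]
    exact_mod_cast this
  have hn1 : n = 1 := by
    rcases Int.eq_one_or_neg_one_of_mul_eq_one hnn with h | h <;> omega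
  have hnq : a ^ 2 - F * b ^ 2 = 1 := by rw [← hn, hn1]; norm_num
  have ht2 : t ^ 2 ≤ 4 := by
    have : (t : ℚ) ^ 2 ≤ 4 := by rw [ht]; nlinarith [sq_nonneg b]
    exact_mod_cast this
  have htc : (t : ℂ) = 2 * a := by exact_mod_cast congrArg (Rat.cast : ℚ → ℂ) ht
  have hnc : (a : ℂ) ^ 2 - F * b ^ 2 = 1 := by exact_mod_cast congrArg (Rat.cast : ℚ → ℂ) hnq
  set z := imEmb F (u : 𝓞 (imQuad F)) with hz
  have hquad : z ^ 2 - t * z + 1 = 0 := by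
    rw [h, htc, ← hnc]
    linear_combination (b ^ 2 : ℂ) * hsq
  have hz12 : z ^ 12 = 1 := by
    have h1 : -2 ≤ t := by nlinarith
    have h2 : t ≤ 2 := by nlinarith
    interval_cases t
    · have : z = -1 := by
        have : (z + 1) ^ 2 = 0 := by push_cast at hquad; linear_combination hquad
        exact eq_neg_of_add_eq_zero_left (pow_eq_zero_iff two_ne_zero |>.1 this)
      rw [this]; norm_num
    · have h3 : z ^ 3 = 1 := by push_cast at hquad; linear_combination (z - 1) * hquad
      calc z ^ 12 = (z ^ 3) ^ 4 := by ring
        _ = 1 := by rw [h3, one_pow]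
    · have h3 : z ^ 2 = -1 := by push_cast at hquad; linear_combination hquad
      calc z ^ 12 = (z ^ 2) ^ 6 := by ring
        _ = 1 := by rw [h3]; norm_num
    · have h3 : z ^ 3 = -1 := by push_cast at hquad; linear_combination (z + 1) * hquad
      calc z ^ 12 = (z ^ 3) ^ 4 := by ring
        _ = 1 := by rw [h3]; norm_num
    · have : z = 1 := by
        have : (z - 1) ^ 2 = 0 := by push_cast at hquad; linear_combination hquad
        exact sub_eq_zero.1 (pow_eq_zero_iff two_ne_zero |>.1 this)
      rw [this]; norm_num
  apply Units.ext
  apply imEmb_injective F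
  rw [Units.val_pow_eq_pow_val, map_pow, ← hz, hz12, Units.val_one, map_one]

/-- Ideal classes killed by `5` are independent as soon as the generators of their fifth powers are
independent modulo fifth powers. -/
lemma exists_injective_of_fifth_powers {F : ℤ} (hF : F < 0) [NumberField (imQuad F)]
    (β : Fin 3 → 𝓞 (imQuad F)) (hβ0 : ∀ i, β i ≠ 0)
    (hβ : ∀ i, ∃ I : Ideal (𝓞 (imQuad F)), Ideal.span {β i} = I ^ 5)
    (hind : ∀ (e : Fin 3 → ℕ) (γ : 𝓞 (imQuad F)), ∏ i, β i ^ e i = γ ^ 5 → ∀ i, 5 ∣ e i) :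
    ∃ f : (Fin 3 → ZMod 5) →+ Additive (ClassGroup (𝓞 (imQuad F))), Function.Injective f := by
  choose I hI using hβ
  have hI0 : ∀ i, I i ∈ nonZeroDivisors (Ideal (𝓞 (imQuad F))) := by
    intro i
    rw [mem_nonZeroDivisors_iff_ne_zero]
    intro h
    have := hI i
    rw [h, zero_pow (by norm_num)] at this
    exact hβ0 i (Ideal.span_singleton_eq_bot.1 this)
  let c : Fin 3 → ClassGroup (𝓞 (imQuad F)) := fun i => ClassGroup.mk0 ⟨I i, hI0 i⟩
  have hc : ∀ i, c i ^ 5 = 1 := by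
    intro i
    rw [← map_pow, ClassGroup.mk0_eq_one_iff]
    refine ⟨⟨β i, ?_⟩⟩
    simpa using (hI i).symm
  let g : Fin 3 → (ZMod 5 →+ Additive (ClassGroup (𝓞 (imQuad F)))) := fun i =>
    ZMod.lift 5 ⟨zmultiplesHom _ (Additive.ofMul (c i)), by
      rw [zmultiplesHom_apply]
      exact congrArg Additive.ofMul (by simpa using hc i)⟩
  have hg : ∀ i (k : ZMod 5), g i k = Additive.ofMul (c i ^ k.val) := by
    intro i k
    conv_lhs => rw [← ZMod.natCast_zmod_val k]
    have : ((k.val : ℕ) : ZMod 5) = ((k.val : ℤ) : ZMod 5) := by simp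
    rw [this]
    simp only [g]
    rw [ZMod.lift_coe]
    change ((k.val : ℕ) : ℤ) • Additive.ofMul (c i) = _
    rw [natCast_zsmul, ofMul_pow]
  refine ⟨∑ i, (g i).comp (Pi.evalAddMonoidHom _ i), ?_⟩
  rw [injective_iff_map_eq_zero]
  intro e he
  have he' : ∏ i, c i ^ (e i).val = 1 := by
    have : ∑ i, Additive.ofMul (c i ^ (e i).val) = 0 := by
      simpa [hg, AddMonoidHom.finsetSum_apply] using he
    rw [← ofMul_prod] at this
    exact this
  have h1 : ClassGroup.mk0
      (∏ i, (⟨I i, hI0 i⟩ : nonZeroDivisors (Ideal (𝓞 (imQuad F)))) ^ (e i).val) = 1 := by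
    rw [map_prod]
    simp only [map_pow]
    exact he'
  rw [ClassGroup.mk0_eq_one_iff] at h1
  obtain ⟨γ, hγ⟩ := h1.principal
  have h2 : Ideal.span {∏ i, β i ^ (e i).val} = Ideal.span {γ ^ 5} := by
    have hγ' : ((∏ i, (⟨I i, hI0 i⟩ : nonZeroDivisors (Ideal (𝓞 (imQuad F)))) ^ (e i).val :
        nonZeroDivisors (Ideal (𝓞 (imQuad F)))) : Ideal (𝓞 (imQuad F))) = Ideal.span {γ} := hγ
    rw [← Ideal.span_singleton_pow γ, ← hγ', ← Ideal.prod_span_singleton]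
    simp only [← Ideal.span_singleton_pow, hI]
    simp only [Submonoid.coe_finsetProd, SubmonoidClass.coe_pow, ← Finset.prod_pow, ← pow_mul,
      mul_comm]
  obtain ⟨u, hu⟩ := Ideal.span_singleton_eq_span_singleton.1 h2.symm
  have h3 : ∏ i, β i ^ (e i).val = (((u ^ 5 : (𝓞 (imQuad F))ˣ) : 𝓞 (imQuad F)) * γ) ^ 5 := by
    rw [mul_pow, ← Units.val_pow_eq_pow_val, ← pow_mul, ← hu]
    have : u ^ (5 * 5) = u := by
      calc u ^ (5 * 5) = (u ^ 12) ^ 2 * u := by group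
        _ = u := by rw [unit_pow_twelve hF, one_pow, one_mul]
    rw [this, mul_comm]
  funext i
  have h4 := hind _ _ h3 i
  have h5 := ZMod.val_lt (e i)
  have h6 : (e i).val = 0 := Nat.eq_zero_of_dvd_of_lt h4 h5
  simpa using (ZMod.val_eq_zero (e i)).1 h6

lemma exists_span_eq_pow_five {F : ℤ} (hF : F < 0) [NumberField (imQuad F)] {U V h : ℤ}
    (hn : U ^ 2 - F * V ^ 2 = h ^ 10) (hc : IsCoprime (2 * U) h) :
    ∃ I : Ideal (𝓞 (imQuad F)), Ideal.span {(U + V * imInt hF : 𝓞 (imQuad F))} = I ^ 5 := by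
  set ω := imInt hF with hω
  have hsq : ω ^ 2 = F := imInt_sq hF
  have hprod : ((U : 𝓞 (imQuad F)) + V * ω) * (U - V * ω) = ((h : 𝓞 (imQuad F)) ^ 2) ^ 5 := by
    have : ((U ^ 2 - F * V ^ 2 : ℤ) : 𝓞 (imQuad F)) = ((h ^ 10 : ℤ) : 𝓞 (imQuad F)) := by rw [hn]
    push_cast at this
    linear_combination this - (V : 𝓞 (imQuad F)) ^ 2 * hsq
  have hcop : IsCoprime ((U : 𝓞 (imQuad F)) + V * ω) (U - V * ω) := by
    obtain ⟨x, y, hxy⟩ := hc.pow_right (n := 10)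
    have : ((x * (2 * U) + y * h ^ 10 : ℤ) : 𝓞 (imQuad F)) = 1 := by rw [hxy]; simp
    push_cast at this
    exact ⟨x + y * (U - V * ω), x, by linear_combination this + y * hprod⟩
  let _ : GCDMonoid (Ideal (𝓞 (imQuad F))) := UniqueFactorizationMonoid.toGCDMonoid _
  refine exists_eq_pow_of_mul_eq_pow_of_coprime (c := Ideal.span {(h : 𝓞 (imQuad F)) ^ 2})
    ((Ideal.isCoprime_span_singleton_iff _ _).2 hcop) ?_
  rw [Ideal.span_singleton_mul_span_singleton, hprod, Ideal.span_singleton_pow]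

lemma five_dvd_of_prod_eq_pow_five {F : ℤ} (hF : F < 0) {U V : Fin 3 → ℤ} {ℓ : ℕ} [Fact ℓ.Prime]
    {k : ℕ} (hk : 5 * k + 1 = ℓ) {r z : ZMod ℓ} (hr : r ^ 2 = F) (hF0 : 2 * (F : ZMod ℓ) ≠ 0)
    (hz : z ^ 5 = 1) (hz1 : z ≠ 1) {a : Fin 3 → ℕ}
    (ha : ∀ i, ((U i : ZMod ℓ) + V i * r) ^ k = z ^ a i) {e : Fin 3 → ℕ} {γ : 𝓞 (imQuad F)}
    (hγ : ∏ i, ((U i : 𝓞 (imQuad F)) + V i * imInt hF) ^ e i = γ ^ 5) :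
    5 ∣ ∑ i, a i * e i := by
  obtain ⟨t, u, htu⟩ := exists_two_mul_eq hF γ
  have hsq : ∀ n : ℤ, F ≠ n * n := fun n h => by nlinarith [mul_self_nonneg n]
  let ι : ℤ√F →+* 𝓞 (imQuad F) := Zsqrtd.lift ⟨imInt hF, by rw [← pow_two, imInt_sq hF]⟩
  have hι : ∀ x y : ℤ, ι ⟨x, y⟩ = x + y * imInt hF := fun x y => rfl
  have hinj : Function.Injective ι := Zsqrtd.lift_injective _ hsq
  let φ : ℤ√F →+* ZMod ℓ := Zsqrtd.lift ⟨r, by rw [← pow_two, hr]⟩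
  have hφ : ∀ x y : ℤ, φ ⟨x, y⟩ = x + y * r := fun x y => rfl
  have key : (2 * (F : ℤ√F)) ^ 5 * ∏ i, (⟨U i, V i⟩ : ℤ√F) ^ e i = ⟨t, u⟩ ^ 5 := by
    apply hinj
    simp only [map_mul, map_pow, map_prod, map_intCast, map_ofNat]
    simp only [hι]
    rw [hγ, ← mul_pow, htu]
  have key2 := congrArg (fun x => φ x ^ k) key
  simp only [map_mul, map_pow, map_prod, map_intCast, map_ofNat] at key2
  simp only [hφ] at key2
  have hsub : 5 * k = ℓ - 1 := by omega
  have hz0 : z ≠ 0 := by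
    rintro rfl
    simp at hz
  have hzk : (∏ i, ((U i : ZMod ℓ) + V i * r) ^ e i) ^ k = z ^ ∑ i, a i * e i := by
    rw [← Finset.prod_pow, ← Finset.prod_pow_eq_pow_sum]
    refine Finset.prod_congr rfl fun i _ => ?_
    rw [← pow_mul, mul_comm (e i), pow_mul, ha, ← pow_mul]
  rw [mul_pow, hzk, ← pow_mul, ← pow_mul, hsub, ZMod.pow_card_sub_one_eq_one hF0, one_mul] at key2
  have hy : ((t : ZMod ℓ) + u * r) ≠ 0 := by
    intro h0
    rw [h0, zero_pow (by have := (Fact.out : ℓ.Prime).two_le; omega)] at key2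
    exact pow_ne_zero _ hz0 key2
  rw [ZMod.pow_card_sub_one_eq_one hy] at key2
  have : Fact (Nat.Prime 5) := ⟨by norm_num⟩
  rw [← orderOf_eq_prime hz hz1]
  exact orderOf_dvd_of_pow_eq_one key2

/-- The forms `x = 2048 p`, `y = 4617 q` parametrise a conic; `conicN` is the common quotient of the
differences of the squares of the three quadratic forms `conicX`. -/
def conicN (p q : ℤ) : ℤ := -(19 * p * q * (4617 * q - 2048 * p) * (8192 * p + 558657 * q))

/-- Three quadratic forms whose squares differ by multiples of `conicN`. -/
def conicX (i : Fin 3) (p q : ℤ) : ℤ :=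
  ![-(121 * (4617 * q) ^ 2) - 4 * (2048 * p) ^ 2,
    4 * (2048 * p) ^ 2 + 242 * (2048 * p) * (4617 * q) - 121 * (4617 * q) ^ 2,
    -(4 * (2048 * p) ^ 2) + 8 * (2048 * p) * (4617 * q) + 121 * (4617 * q) ^ 2] i

/-- The quartic form with `conicS - e * conicN` a square for the three curves `torsionData`. -/
def conicS (p q : ℤ) : ℤ := conicX 1 p q ^ 2 - 217195000 * conicN p q

/-- The radicand of the imaginary quadratic fields. -/
def radicand (p q : ℤ) : ℤ :=
  conicN p q * (conicS p q ^ 2 - 64 * 385 ^ 5 * conicN p q ^ 2)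

/-- The data of an elliptic curve `y² = (s - e) (s² - 64 * 385⁵)` with a point of order five at
`s = t`, together with the coefficients of the function with divisor `5 (P) - 5 (O)`. -/
structure TorsionDatum where
  /-- The abscissa of the rational two-torsion point. -/
  e : ℤ
  /-- The abscissa of the five-torsion point. -/
  t : ℤ
  /-- A coefficient of the linear factor `b`. -/
  α : ℤ
  /-- A scaling factor. -/
  g : ℤ
  /-- A coefficient of the quadratic factor `a`. -/
  c₁ : ℤ
  /-- A coefficient of the quadratic factor `a`. -/
  c₂ : ℤ

namespace TorsionDatum

variable (d : TorsionDatum) (S N X : ℤ)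

/-- The linear form vanishing at the five-torsion point. -/
def h : ℤ := S - d.t * N

/-- The linear factor of the function with divisor `5 (P) - 5 (O)`. -/
def b : ℤ := d.h S N + d.α * N

/-- The quadratic factor of the function with divisor `5 (P) - 5 (O)`. -/
def a : ℤ := d.c₁ * d.b S N ^ 2 - d.c₂ * d.h S N * (3 * d.h S N + d.α * N)

/-- The rational part of the square of the function with divisor `5 (P) - 5 (O)`. -/
def u : ℤ :=
  N * d.g ^ 2 * d.a S N ^ 2 + X ^ 2 * d.b S N ^ 2 * (S ^ 2 - 64 * 385 ^ 5 * N ^ 2)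

/-- The irrational part of the square of the function with divisor `5 (P) - 5 (O)`. -/
def v : ℤ := 2 * d.a S N * d.b S N * X * d.g

/-- The curve has a five-torsion point with the prescribed function. -/
def IsFiveTorsion : Prop :=
  ∀ S N : ℤ, (S - d.e * N) * d.b S N ^ 2 * (S ^ 2 - 64 * 385 ^ 5 * N ^ 2) -
    N * d.g ^ 2 * d.a S N ^ 2 = d.h S N ^ 5

variable {d S N X}

lemma u_eq (hd : d.IsFiveTorsion) (hX : X ^ 2 = S - d.e * N) :
    d.u S N X = 2 * (N * d.g ^ 2 * d.a S N ^ 2) + d.h S N ^ 5 := by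
  rw [u, hX, ← hd S N]
  ring

lemma norm_eq (hd : d.IsFiveTorsion) (hX : X ^ 2 = S - d.e * N) :
    d.u S N X ^ 2 - N * (S ^ 2 - 64 * 385 ^ 5 * N ^ 2) * d.v S N X ^ 2 = d.h S N ^ 10 := by
  have h5 : X ^ 2 * d.b S N ^ 2 * (S ^ 2 - 64 * 385 ^ 5 * N ^ 2) - N * d.g ^ 2 * d.a S N ^ 2 =
      d.h S N ^ 5 := by rw [hX, hd S N]
  calc _ = (X ^ 2 * d.b S N ^ 2 * (S ^ 2 - 64 * 385 ^ 5 * N ^ 2) -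
        N * d.g ^ 2 * d.a S N ^ 2) ^ 2 := by rw [u, v]; ring
    _ = _ := by rw [h5]; ring

lemma isCoprime_two_mul_u (hd : d.IsFiveTorsion) (hX : X ^ 2 = S - d.e * N)
    (h0 : IsCoprime (d.h S N) 2310) (hN : IsCoprime (d.h S N) N)
    (hα : d.α ∣ 2310 ^ 10) (hg : d.g ∣ 2310 ^ 10) (hc : d.c₁ ∣ 2310 ^ 10) :
    IsCoprime (2 * d.u S N X) (d.h S N) := by
  have hpow : ∀ {c : ℤ}, c ∣ 2310 ^ 10 → IsCoprime (d.h S N) c := fun hc =>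
    (h0.pow_right (n := 10)).of_isCoprime_of_dvd_right hc
  have h2 : IsCoprime (d.h S N) 2 := h0.of_isCoprime_of_dvd_right (by norm_num)
  have hb : IsCoprime (d.h S N) (d.b S N) := by
    have := ((hpow hα).mul_right hN).add_mul_left_right 1
    rwa [mul_one, add_comm] at this
  have ha : IsCoprime (d.h S N) (d.a S N) := by
    have := ((hpow hc).mul_right (hb.pow_right (n := 2))).add_mul_left_right
      (-(d.c₂ * (3 * d.h S N + d.α * N)))
    rwa [show d.c₁ * d.b S N ^ 2 + d.h S N * -(d.c₂ * (3 * d.h S N + d.α * N)) = d.a S N by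
      rw [a]; ring] at this
  rw [isCoprime_comm]
  refine h2.mul_right ?_
  have := (h2.mul_right ((hN.mul_right ((hpow hg).pow_right (n := 2))).mul_right
    (ha.pow_right (n := 2)))).add_mul_left_right (d.h S N ^ 4)
  rwa [show 2 * (N * d.g ^ 2 * d.a S N ^ 2) + d.h S N * d.h S N ^ 4 = d.u S N X by
    rw [u_eq hd hX]; ring] at this

lemma u_homogeneous (r : ℤ) : d.u (r ^ 4 * S) (r ^ 4 * N) (r ^ 2 * X) = r ^ 20 * d.u S N X := by
  simp only [u, a, b, h]
  ring

lemma v_homogeneous (r : ℤ) : d.v (r ^ 4 * S) (r ^ 4 * N) (r ^ 2 * X) = r ^ 14 * d.v S N X := by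
  simp only [v, a, b, h]
  ring

end TorsionDatum

/-- Three curves `y² = (s - e) (s² - 64 * 385⁵)` with a point of order five. -/
def torsionData : Fin 3 → TorsionDatum :=
  ![⟨23674376, 23953160, 379456, 11, 720, 28⟩,
    ⟨-217195000, 33710600, 15681600, 55, 448, 36⟩,
    ⟨31637000, 33710600, 3097600, 5, 2268, 176⟩]

lemma isFiveTorsion_torsionData (i : Fin 3) : (torsionData i).IsFiveTorsion := by
  intro S N
  fin_cases i <;>
  · simp [torsionData, TorsionDatum.a, TorsionDatum.b, TorsionDatum.h]
    ring

lemma conicX_sq (i : Fin 3) (p q : ℤ) :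
    conicX i p q ^ 2 = conicS p q - (torsionData i).e * conicN p q := by
  fin_cases i <;>
  · simp [torsionData, conicS, conicX, conicN]
    try ring

/-- The rational part of the `i`-th element. -/
def elemU (i : Fin 3) (p q : ℤ) : ℤ := (torsionData i).u (conicS p q) (conicN p q) (conicX i p q)

/-- The irrational part of the `i`-th element. -/
def elemV (i : Fin 3) (p q : ℤ) : ℤ := (torsionData i).v (conicS p q) (conicN p q) (conicX i p q)

/-- The tenth root of the norm of the `i`-th element. -/
def elemH (i : Fin 3) (p q : ℤ) : ℤ := (torsionData i).h (conicS p q) (conicN p q)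

lemma norm_elem (i : Fin 3) (p q : ℤ) :
    elemU i p q ^ 2 - radicand p q * elemV i p q ^ 2 = elemH i p q ^ 10 :=
  TorsionDatum.norm_eq (isFiveTorsion_torsionData i) (conicX_sq i p q)

lemma isCoprime_elemH_conicN {i : Fin 3} {p q : ℤ} (hpq : IsCoprime (2048 * p) (4617 * q))
    (h : IsCoprime (elemH i p q) 2310) : IsCoprime (elemH i p q) (conicN p q) := by
  refine isCoprime_of_prime_dvd ?_ ?_
  · rintro ⟨h0, -⟩
    rw [h0, isCoprime_zero_left] at h
    exact absurd h (by decide)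
  intro z hz hzh hzN
  have hz0 : ∀ {c : ℤ}, z ∣ c → ¬ c ∣ 2310 ^ 10 := fun hzc hc =>
    hz.not_isUnit (h.isUnit_of_dvd' hzh (hz.dvd_of_dvd_pow (hzc.trans hc)))
  have hS : z ∣ conicS p q := by
    have := dvd_add hzh (hzN.mul_left (torsionData i).t)
    simpa [elemH, TorsionDatum.h] using this
  have hX : ∀ j, z ∣ conicX j p q := fun j =>
    hz.dvd_of_dvd_pow (conicX_sq j p q ▸ dvd_sub hS (hzN.mul_left _))
  have e0 := hX 0
  have e12 : z ∣ 250 * ((2048 * p) * (4617 * q)) := by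
    have e : 250 * ((2048 * p) * (4617 * q)) = conicX 1 p q + conicX 2 p q := by
      simp only [conicX, Matrix.cons_val]
      ring
    exact e ▸ dvd_add (hX 1) (hX 2)
  simp only [conicX, Matrix.cons_val] at e0
  rcases hz.dvd_or_dvd e12 with h1 | h1
  · exact hz0 h1 (by norm_num)
  rcases hz.dvd_or_dvd h1 with hx | hy
  · have : z ∣ 121 * (4617 * q) ^ 2 := by
      have := dvd_add e0 ((dvd_pow hx two_ne_zero).mul_left 4)
      rw [sub_add_cancel, dvd_neg] at this
      exact this
    rcases hz.dvd_or_dvd this with h2 | h2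
    · exact hz0 h2 (by norm_num)
    · exact hz.not_isUnit (hpq.isUnit_of_dvd' hx (hz.dvd_of_dvd_pow h2))
  · have : z ∣ 4 * (2048 * p) ^ 2 := by
      have e : 4 * (2048 * p) ^ 2 = -(121 * (4617 * q) ^ 2) -
          (-(121 * (4617 * q) ^ 2) - 4 * (2048 * p) ^ 2) := by ring
      exact e ▸ dvd_sub ((dvd_pow hy two_ne_zero).mul_left 121).neg_right e0
    rcases hz.dvd_or_dvd this with h2 | h2
    · exact hz0 h2 (by norm_num)
    · exact hz.not_isUnit (hpq.isUnit_of_dvd' (hz.dvd_of_dvd_pow h2) hy)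

lemma isCoprime_elem {i : Fin 3} {p q : ℤ} (hpq : IsCoprime (2048 * p) (4617 * q))
    (h : IsCoprime (elemH i p q) 2310) : IsCoprime (2 * elemU i p q) (elemH i p q) := by
  refine TorsionDatum.isCoprime_two_mul_u (isFiveTorsion_torsionData i) (conicX_sq i p q) h
    (isCoprime_elemH_conicN hpq h) ?_ ?_ ?_ <;>
  fin_cases i <;>
  simp only [torsionData, Fin.zero_eta, Fin.mk_one, Fin.reduceFinMk, Matrix.cons_val] <;> norm_num

lemma conicX_modEq {n p q : ℤ} (h : q ≡ p [ZMOD n]) (i : Fin 3) :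
    conicX i p q ≡ p ^ 2 * conicX i 1 1 [ZMOD n] := by
  have e : p ^ 2 * conicX i 1 1 = conicX i p p := by
    fin_cases i <;>
    · simp [conicX]
      ring
  rw [e]
  fin_cases i <;>
  · simp only [conicX, Fin.zero_eta, Fin.mk_one, Fin.reduceFinMk, Matrix.cons_val]
    gcongr

lemma conicN_modEq {n p q : ℤ} (h : q ≡ p [ZMOD n]) :
    conicN p q ≡ p ^ 4 * conicN 1 1 [ZMOD n] := by
  have e : p ^ 4 * conicN 1 1 = conicN p p := by
    simp only [conicN]
    ring
  rw [e]
  simp only [conicN]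
  gcongr

lemma conicS_modEq {n p q : ℤ} (h : q ≡ p [ZMOD n]) :
    conicS p q ≡ p ^ 4 * conicS 1 1 [ZMOD n] := by
  have e : p ^ 4 * conicS 1 1 = (p ^ 2 * conicX 1 1 1) ^ 2 - 217195000 * (p ^ 4 * conicN 1 1) := by
    simp only [conicS]
    ring
  rw [e, conicS]
  exact ((conicX_modEq h 1).pow 2).sub ((conicN_modEq h).mul_left _)

lemma radicand_modEq {n p q : ℤ} (h : q ≡ p [ZMOD n]) :
    radicand p q ≡ p ^ 12 * radicand 1 1 [ZMOD n] := by
  have hN := conicN_modEq h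
  have hS := conicS_modEq h
  have e : p ^ 12 * radicand 1 1 = (p ^ 4 * conicN 1 1) *
      ((p ^ 4 * conicS 1 1) ^ 2 - 64 * 385 ^ 5 * (p ^ 4 * conicN 1 1) ^ 2) := by
    simp only [radicand]
    ring
  rw [e, radicand]
  gcongr

lemma elemH_modEq {n p q : ℤ} (h : q ≡ p [ZMOD n]) (i : Fin 3) :
    elemH i p q ≡ p ^ 4 * elemH i 1 1 [ZMOD n] := by
  have hN := conicN_modEq h
  have hS := conicS_modEq h
  have e : p ^ 4 * elemH i 1 1 =
      p ^ 4 * conicS 1 1 - (torsionData i).t * (p ^ 4 * conicN 1 1) := by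
    simp only [elemH, TorsionDatum.h]
    ring
  rw [e, elemH, TorsionDatum.h]
  gcongr

lemma elemU_modEq {n p q : ℤ} (h : q ≡ p [ZMOD n]) (i : Fin 3) :
    elemU i p q ≡ p ^ 20 * elemU i 1 1 [ZMOD n] := by
  have hN := conicN_modEq h
  have hS := conicS_modEq h
  have hX := conicX_modEq h i
  rw [elemU, elemU, ← TorsionDatum.u_homogeneous]
  simp only [TorsionDatum.u, TorsionDatum.a, TorsionDatum.b, TorsionDatum.h]
  gcongr

lemma elemV_modEq {n p q : ℤ} (h : q ≡ p [ZMOD n]) (i : Fin 3) :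
    elemV i p q ≡ p ^ 14 * elemV i 1 1 [ZMOD n] := by
  have hN := conicN_modEq h
  have hS := conicS_modEq h
  have hX := conicX_modEq h i
  rw [elemV, elemV, ← TorsionDatum.v_homogeneous]
  simp only [TorsionDatum.v, TorsionDatum.a, TorsionDatum.b, TorsionDatum.h]
  gcongr

/-- The modulus in whose residue classes the parameters are chosen. -/
def badModulus : ℕ := 2310 * 31 * 41 * 151

lemma isCoprime_elemH {p q : ℤ} (hp : IsCoprime p 2310) (h : q ≡ p [ZMOD 2310]) (i : Fin 3) :
    IsCoprime (elemH i p q) 2310 := by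
  have h1 : IsCoprime (p ^ 4 * elemH i 1 1) 2310 := by
    refine (hp.pow_left (m := 4)).mul_left ?_
    rw [Int.isCoprime_iff_gcd_eq_one]
    fin_cases i <;> decide
  obtain ⟨k, hk⟩ := (elemH_modEq h i).symm.dvd
  have := h1.add_mul_left_left k
  rwa [← hk, add_sub_cancel] at this

lemma five_dvd_sum {p q : ℤ} (hF : radicand p q < 0) {ℓ : ℕ} (hℓ : ℓ.Prime)
    {k : ℕ} (hk : 5 * k + 1 = ℓ) {s z : ℤ} {a : Fin 3 → ℕ}
    (hpq : q ≡ p [ZMOD ℓ]) (hp : IsCoprime p ℓ)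
    (hs : s ^ 2 ≡ radicand 1 1 [ZMOD ℓ]) (h0 : ¬ 2 * radicand 1 1 ≡ 0 [ZMOD ℓ])
    (hz : z ^ 5 ≡ 1 [ZMOD ℓ]) (hz1 : ¬ z ≡ 1 [ZMOD ℓ])
    (ha : ∀ i, (elemU i 1 1 + elemV i 1 1 * s) ^ k ≡ z ^ a i [ZMOD ℓ])
    {e : Fin 3 → ℕ} {γ : 𝓞 (imQuad (radicand p q))}
    (hγ : ∏ i, ((elemU i p q : 𝓞 (imQuad (radicand p q))) + elemV i p q * imInt hF) ^ e i =
      γ ^ 5) :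
    5 ∣ ∑ i, a i * e i := by
  have : Fact ℓ.Prime := ⟨hℓ⟩
  have hp0 : (p : ZMod ℓ) ≠ 0 := by
    intro h
    rw [ZMod.intCast_zmod_eq_zero_iff_dvd] at h
    exact (Nat.prime_iff_prime_int.1 hℓ).not_isUnit (hp.isUnit_of_dvd' h dvd_rfl)
  have toZ : ∀ {x y : ℤ}, x ≡ y [ZMOD ℓ] → (x : ZMod ℓ) = y := fun h =>
    (ZMod.intCast_eq_intCast_iff _ _ _).2 h
  have toZ' : ∀ {x y : ℤ}, ¬ x ≡ y [ZMOD ℓ] → (x : ZMod ℓ) ≠ y := fun h h' =>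
    h ((ZMod.intCast_eq_intCast_iff _ _ _).1 h')
  have hR := toZ (radicand_modEq hpq)
  have hs' := toZ hs
  push_cast at hR hs'
  refine five_dvd_of_prod_eq_pow_five hF (r := p ^ 6 * s) (z := (z : ZMod ℓ)) hk ?_ ?_ ?_ ?_
    (fun i => ?_) hγ
  · rw [hR, ← hs']
    ring
  · rw [hR, mul_left_comm]
    refine mul_ne_zero (pow_ne_zero _ hp0) ?_
    have := toZ' h0
    push_cast at this
    exact this
  · have := toZ hz
    push_cast at this
    exact this
  · have := toZ' hz1
    push_cast at this
    exact this
  · have hU := toZ (elemU_modEq hpq i)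
    have hV := toZ (elemV_modEq hpq i)
    have h1 := toZ (ha i)
    push_cast at hU hV h1
    have hpow : ((p : ZMod ℓ) ^ 20) ^ k = 1 := by
      rw [← pow_mul, show 20 * k = (ℓ - 1) * 4 by omega, pow_mul,
        ZMod.pow_card_sub_one_eq_one hp0, one_pow]
    rw [hU, hV, ← h1]
    calc _ = ((p : ZMod ℓ) ^ 20 * (elemU i 1 1 + elemV i 1 1 * s)) ^ k := by ring
      _ = _ := by rw [mul_pow, hpow, one_mul]

lemma exists_injective_radicand {p q : ℤ} (hF : radicand p q < 0)
    (hp : IsCoprime p badModulus) (hpq : q ≡ p [ZMOD badModulus])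
    (hc : IsCoprime (2048 * p) (4617 * q)) [NumberField (imQuad (radicand p q))] :
    ∃ f : (Fin 3 → ZMod 5) →+ Additive (ClassGroup (𝓞 (imQuad (radicand p q)))),
      Function.Injective f := by
  have hdvd : ∀ {m : ℤ}, m ∣ badModulus → IsCoprime p m ∧ q ≡ p [ZMOD m] := fun hm =>
    ⟨hp.of_isCoprime_of_dvd_right hm, hpq.of_dvd hm⟩
  obtain ⟨hp0, hpq0⟩ := hdvd (m := 2310) (by decide)
  have hcop := fun i => isCoprime_elem hc (isCoprime_elemH hp0 hpq0 i)
  have hsp := fun i => exists_span_eq_pow_five hF (norm_elem i p q) (hcop i)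
  refine exists_injective_of_fifth_powers hF
    (fun i => elemU i p q + elemV i p q * imInt hF) (fun i h => ?_) hsp ?_
  · have e : ((elemU i p q ^ 2 - radicand p q * elemV i p q ^ 2 : ℤ) :
        𝓞 (imQuad (radicand p q))) = 0 := by
      push_cast
      rw [← imInt_sq hF]
      linear_combination (elemU i p q - elemV i p q * imInt hF) * h
    rw [norm_elem, Int.cast_eq_zero] at e
    have h2 := isCoprime_elemH hp0 hpq0 i
    rw [pow_eq_zero_iff (by norm_num) |>.1 e, isCoprime_zero_left] at h2
    exact absurd h2 (by decide)
  · intro e γ hγ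
    obtain ⟨c1, m1⟩ := hdvd (m := (31 : ℕ)) (by decide)
    obtain ⟨c2, m2⟩ := hdvd (m := (41 : ℕ)) (by decide)
    obtain ⟨c3, m3⟩ := hdvd (m := (151 : ℕ)) (by decide)
    have d1 := five_dvd_sum hF (ℓ := 31) (k := 6) (s := 11) (z := 2) (a := ![2, 4, 3])
      (by norm_num) rfl m1 c1 (by decide) (by decide) (by decide) (by decide) (by decide) hγ
    have d2 := five_dvd_sum hF (ℓ := 41) (k := 8) (s := 11) (z := 10) (a := ![0, 4, 2])
      (by norm_num) rfl m2 c2 (by decide) (by decide) (by decide) (by decide) (by decide) hγ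
    have d3 := five_dvd_sum hF (ℓ := 151) (k := 30) (s := 22) (z := 59) (a := ![2, 4, 2])
      (by norm_num) rfl m3 c3 (by decide) (by decide) (by decide) (by decide) (by decide) hγ
    simp only [Fin.sum_univ_three, Matrix.cons_val] at d1 d2 d3
    intro i
    fin_cases i <;> simp only [Fin.zero_eta, Fin.mk_one, Fin.reduceFinMk] <;> omega

lemma conicN_neg {p q : ℤ} (hp : 0 < p) (hpq : p < q) : conicN p q < 0 := by
  have h1 : 0 < 4617 * q - 2048 * p := by linarith
  have h2 : 0 < 8192 * p + 558657 * q := by linarith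
  have hq : 0 < q := hp.trans hpq
  rw [conicN, neg_neg_iff_pos]
  positivity

lemma le_conicS (p q : ℤ) : -(217195000 * conicN p q) ≤ conicS p q := by
  have := sq_nonneg (conicX 1 p q)
  rw [conicS]
  linarith

lemma radicand_factor_pos {p q : ℤ} (hp : 0 < p) (hpq : p < q) :
    0 < conicS p q ^ 2 - 64 * 385 ^ 5 * conicN p q ^ 2 := by
  have hN := conicN_neg hp hpq
  have h1 := le_conicS p q
  have h2 : (-(217195000 * conicN p q)) ^ 2 ≤ conicS p q ^ 2 :=
    pow_le_pow_left₀ (by linarith) h1 2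
  have h3 : 0 < conicN p q ^ 2 := sq_pos_of_neg hN
  linarith

lemma radicand_neg {p q : ℤ} (hp : 0 < p) (hpq : p < q) : radicand p q < 0 :=
  mul_neg_of_neg_of_pos (conicN_neg hp hpq) (radicand_factor_pos hp hpq)

lemma neg_radicand_le {p q n : ℤ} (hp : 0 < p) (hpq : p < q) (hqn : q ≤ n) :
    -radicand p q ≤ 4 * 10 ^ 51 * n ^ 12 := by
  have hq := hp.trans hpq
  have hn : 0 < n := by linarith
  have hpn : p ≤ n := by linarith
  have hpp : p ^ 2 ≤ n ^ 2 := pow_le_pow_left₀ hp.le hpn 2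
  have hqq : q ^ 2 ≤ n ^ 2 := pow_le_pow_left₀ hq.le hqn 2
  have hpq2 : p * q ≤ n ^ 2 := by rw [pow_two]; gcongr
  have hpq0 : 0 < p * q := mul_pos hp hq
  have hN := conicN_neg hp hpq
  have hN1 : -conicN p q ≤ 10 ^ 11 * n ^ 4 := by
    have h1 : 4617 * q - 2048 * p ≤ 4617 * n := by linarith
    have h2 : 8192 * p + 558657 * q ≤ 566849 * n := by linarith
    have h3 : 0 ≤ 4617 * q - 2048 * p := by linarith
    calc -conicN p q = 19 * (p * q) * ((4617 * q - 2048 * p) * (8192 * p + 558657 * q)) := by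
          rw [conicN]; ring
      _ ≤ 19 * n ^ 2 * ((4617 * n) * (566849 * n)) := by gcongr
      _ = 19 * 4617 * 566849 * n ^ 4 := by ring
      _ ≤ _ := by gcongr; norm_num
  have hX : |conicX 1 p q| ≤ 10 ^ 10 * n ^ 2 := by
    simp only [conicX, Matrix.cons_val]
    rw [abs_le]
    constructor <;> nlinarith
  have hS : conicS p q ≤ 2 * 10 ^ 20 * n ^ 4 := by
    have h1 : conicX 1 p q ^ 2 ≤ (10 ^ 10 * n ^ 2) ^ 2 := sq_le_sq.2 (hX.trans (le_abs_self _))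
    rw [conicS]
    nlinarith [pow_pos hn 4]
  have hS0 : 0 ≤ conicS p q := by linarith [le_conicS p q]
  have hG := radicand_factor_pos hp hpq
  calc -radicand p q =
        -conicN p q * (conicS p q ^ 2 - 64 * 385 ^ 5 * conicN p q ^ 2) := by rw [radicand]; ring
    _ ≤ (10 ^ 11 * n ^ 4) * (2 * 10 ^ 20 * n ^ 4) ^ 2 := by
        refine mul_le_mul hN1 ?_ hG.le (by positivity)
        have := pow_le_pow_left₀ hS0 hS 2
        nlinarith [sq_nonneg (conicN p q)]
    _ = _ := by ring

/-- The first-order expansion in `x` of `N * (S ^ 2 - c * N ^ 2)` for `N = x * M` and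
`S = x * B + s`. -/
lemma exists_mul_sub_eq {x c M A m B s : ℤ} (hM : M = x * A + m) :
    ∃ k : ℤ, x * M * ((x * B + s) ^ 2 - c * (x * M) ^ 2) = x * (x * k + m * s ^ 2) := by
  refine ⟨A * s ^ 2 + M * (x * B ^ 2 + 2 * B * s - c * x * M ^ 2), ?_⟩
  linear_combination x * s ^ 2 * hM

lemma exists_radicand_eq_left (p q : ℤ) : ∃ k : ℤ, radicand p q =
    p * (p * k - 19 * 121 ^ 5 * 4617 ^ 10 * q ^ 11) := by
  obtain ⟨k, hk⟩ := exists_mul_sub_eq (x := p) (c := 64 * 385 ^ 5)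
    (M := -(19 * q * (4617 * q - 2048 * p) * (8192 * p + 558657 * q)))
    (A := -(19 * q * (4617 * 8192 * q - 2048 * 8192 * p - 2048 * 558657 * q)))
    (m := -(19 * 121 * 4617 ^ 2 * q ^ 3))
    (B := (4 * 2048 ^ 2 * p + 242 * 2048 * 4617 * q) *
        (p * (4 * 2048 ^ 2 * p + 242 * 2048 * 4617 * q) - 242 * 4617 ^ 2 * q ^ 2) -
        217195000 * -(19 * q * (4617 * q - 2048 * p) * (8192 * p + 558657 * q)))
    (s := 121 ^ 2 * 4617 ^ 4 * q ^ 4) (by ring)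
  refine ⟨k, ?_⟩
  rw [show p * (p * k - 19 * 121 ^ 5 * 4617 ^ 10 * q ^ 11) =
    p * (p * k + -(19 * 121 * 4617 ^ 2 * q ^ 3) * (121 ^ 2 * 4617 ^ 4 * q ^ 4) ^ 2) by ring, ← hk]
  simp only [radicand, conicS, conicX, conicN, Matrix.cons_val]
  congr 1
  · ring
  · congr 2
    · ring
    · ring

lemma exists_radicand_eq_right (p q : ℤ) : ∃ k : ℤ, radicand p q =
    q * (q * k + 19 * 2 ^ 120 * p ^ 11) := by
  obtain ⟨k, hk⟩ := exists_mul_sub_eq (x := q) (c := 64 * 385 ^ 5)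
    (M := -(19 * p * (4617 * q - 2048 * p) * (8192 * p + 558657 * q)))
    (A := -(19 * p * (4617 * 8192 * p - 2048 * 558657 * p + 4617 * 558657 * q)))
    (m := 19 * 2 ^ 24 * p ^ 3)
    (B := (242 * 2048 * 4617 * p - 121 * 4617 ^ 2 * q) *
        (q * (242 * 2048 * 4617 * p - 121 * 4617 ^ 2 * q) + 8 * 2048 ^ 2 * p ^ 2) -
        217195000 * -(19 * p * (4617 * q - 2048 * p) * (8192 * p + 558657 * q)))
    (s := 2 ^ 48 * p ^ 4) (by ring)
  refine ⟨k, ?_⟩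
  rw [show q * (q * k + 19 * 2 ^ 120 * p ^ 11) =
    q * (q * k + 19 * 2 ^ 24 * p ^ 3 * (2 ^ 48 * p ^ 4) ^ 2) by ring, ← hk]
  simp only [radicand, conicS, conicX, conicN, Matrix.cons_val]
  congr 1
  · ring
  · congr 2
    · ring
    · ring

/-- A prime dividing `F` exactly once divides `G` as soon as `F * G` is a square. -/
lemma dvd_of_isSquare_mul {x G a F : ℤ} (hx : Prime x) (ha : ¬ x ∣ a) (hF : F = x * a)
    (hs : IsSquare (F * G)) : x ∣ G := by
  obtain ⟨z, hz⟩ := hs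
  have h1 : x ∣ z := by
    have : x ∣ z * z := hz ▸ hF ▸ (dvd_mul_right x a).mul_right G
    exact (hx.dvd_or_dvd this).elim id id
  obtain ⟨w, rfl⟩ := h1
  have h2 : a * G = x * (w * w) := by
    apply mul_left_cancel₀ hx.ne_zero
    linear_combination hz - G * hF
  exact (hx.dvd_or_dvd ⟨_, h2⟩).resolve_left ha

/-- A large prime does not divide a number with small prime factors. -/
lemma not_dvd_of_badModulus_lt {p : ℕ} (hp : p.Prime) (hb : badModulus < p) {c d : ℕ} {n : ℕ}
    (hc : c ∣ d ^ n) (hd : 0 < d) (hdb : d ≤ badModulus) : ¬ (p : ℤ) ∣ c := by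
  intro h
  have := Nat.le_of_dvd hd (hp.dvd_of_dvd_pow ((Int.natCast_dvd_natCast.1 h).trans hc))
  omega

lemma dvd_of_isSquare_radicand_mul {p q : ℕ} (hp : p.Prime) (hq : q.Prime) (hpq : p ≠ q)
    (hpb : badModulus < p) (hqb : badModulus < q) {G : ℤ} (h : IsSquare (radicand p q * G)) :
    (p : ℤ) ∣ G ∧ (q : ℤ) ∣ G := by
  have hp' := Nat.prime_iff_prime_int.1 hp
  have hq' := Nat.prime_iff_prime_int.1 hq
  constructor
  · obtain ⟨k, hk⟩ := exists_radicand_eq_left p q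
    refine dvd_of_isSquare_mul hp' (fun hd => ?_) hk h
    rw [dvd_sub_right (dvd_mul_right _ _)] at hd
    rcases hp'.dvd_or_dvd hd with h1 | h1
    · have e : (19 * 121 ^ 5 * 4617 ^ 10 : ℤ) = (19 * 121 ^ 5 * 4617 ^ 10 : ℕ) := by norm_num
      rw [e] at h1
      exact not_dvd_of_badModulus_lt hp hpb (d := 3 * 11 * 19) (n := 50) (by norm_num) (by norm_num)
        (by decide) h1
    · exact hpq ((Nat.prime_dvd_prime_iff_eq hp hq).1
        (Int.natCast_dvd_natCast.1 (hp'.dvd_of_dvd_pow h1)))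
  · obtain ⟨k, hk⟩ := exists_radicand_eq_right p q
    refine dvd_of_isSquare_mul hq' (fun hd => ?_) hk h
    rw [dvd_add_right (dvd_mul_right _ _)] at hd
    rcases hq'.dvd_or_dvd hd with h1 | h1
    · have e : (19 * 2 ^ 120 : ℤ) = (19 * 2 ^ 120 : ℕ) := by norm_num
      rw [e] at h1
      exact not_dvd_of_badModulus_lt hq hqb (d := 2 * 19) (n := 120) (by norm_num) (by norm_num)
        (by decide) h1
    · exact hpq ((Nat.prime_dvd_prime_iff_eq hq hp).1
        (Int.natCast_dvd_natCast.1 (hq'.dvd_of_dvd_pow h1))).symm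

lemma isCoprime_params {p q : ℕ} (hp : p.Prime) (hq : q.Prime) (hpq : p ≠ q)
    (hpb : badModulus < p) (hqb : badModulus < q) : IsCoprime (2048 * p : ℤ) (4617 * q) := by
  have h0 : ∀ {x y : ℕ}, x.Prime → badModulus < x → y ≠ 0 → y ≤ badModulus → Nat.Coprime x y :=
    fun hx hb hy hyb => (Nat.Prime.coprime_iff_not_dvd hx).2 fun h => by
      have := Nat.le_of_dvd (Nat.pos_of_ne_zero hy) h
      omega
  have h1 : Nat.Coprime (2048 * p) (4617 * q) := by
    refine Nat.Coprime.mul_left (Nat.Coprime.mul_right (by norm_num) ?_)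
      (Nat.Coprime.mul_right (h0 hp hpb (by norm_num) (by decide)) ?_)
    · exact (h0 hq hqb (by norm_num) (by decide)).symm
    · exact (Nat.coprime_primes hp hq).2 hpq
  exact_mod_cast Nat.isCoprime_iff_coprime.2 h1

lemma card_le_of_primes_dvd {n m k : ℕ} (hm : m ≠ 0) (hmn : m < n ^ k) {P : Finset ℕ}
    (hP : ∀ p ∈ P, p.Prime ∧ n.sqrt < p ∧ p ∣ m) : P.card < 2 * k := by
  by_contra! h
  have h1 : (n.sqrt + 1) ^ P.card ≤ ∏ p ∈ P, p :=
    Finset.pow_card_le_prod P _ _ fun p hp => (hP p hp).2.1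
  have h2 : ∏ p ∈ P, p ≤ m := Nat.le_of_dvd (Nat.pos_of_ne_zero hm)
    (Finset.prod_primes_dvd _ (fun p hp => (hP p hp).1.prime) fun p hp => (hP p hp).2.2)
  have h3 : (n.sqrt + 1) ^ (2 * k) ≤ (n.sqrt + 1) ^ P.card := Nat.pow_le_pow_right (by omega) h
  have h4 : n ^ k ≤ (n.sqrt + 1) ^ (2 * k) := by
    rw [pow_mul]
    exact Nat.pow_le_pow_left (Nat.lt_succ_sqrt' n).le k
  omega

lemma card_offDiag_le (T : Finset ℕ) :
    T.card * T.card ≤ 2 * (T.offDiag.filter fun x => x.1 < x.2).card + T.card := by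
  have h1 := T.offDiag.card_filter_add_card_filter_not (fun x => x.1 < x.2)
  have h2 : (T.offDiag.filter fun x => ¬ x.1 < x.2).card ≤
      (T.offDiag.filter fun x => x.1 < x.2).card := by
    refine Finset.card_le_card_of_injOn Prod.swap ?_ Prod.swap_injective.injOn
    rintro ⟨a, b⟩ h
    simp only [Finset.coe_filter, Finset.mem_offDiag, Set.mem_ofPred_eq, Prod.swap] at h ⊢
    refine ⟨⟨h.1.2.1, h.1.1, h.1.2.2.symm⟩, ?_⟩
    omega
  rw [Finset.offDiag_card] at h1
  omega

lemma exists_finset_imQuad {n : ℕ} (hn : 4 * 10 ^ 51 < n) {T : Finset ℕ}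
    (hT : ∀ p ∈ T, p.Prime ∧ n.sqrt < p ∧ p ≤ n) :
    ∃ S : Finset (Subfield ℂ),
      (∀ K ∈ S, ∃ p ∈ T, ∃ q ∈ T, p < q ∧ K = imQuad (radicand p q)) ∧
      T.card * T.card ≤ 1250 * S.card + T.card := by
  classical
  have hbad : badModulus ≤ n.sqrt :=
    Nat.le_sqrt.2 (le_trans (by norm_num [badModulus]) hn.le)
  let A := T.offDiag.filter fun x => x.1 < x.2
  have hA : ∀ {x}, x ∈ A → x.1 ∈ T ∧ x.2 ∈ T ∧ x.1 < x.2 := by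
    intro x hx
    simp only [A, Finset.mem_filter, Finset.mem_offDiag] at hx
    exact ⟨hx.1.1, hx.1.2.1, hx.2⟩
  let f : ℕ × ℕ → Subfield ℂ := fun x => imQuad (radicand x.1 x.2)
  have hneg : ∀ {x}, x ∈ A → radicand x.1 x.2 < 0 := fun hx =>
    radicand_neg (by exact_mod_cast (hT _ (hA hx).1).1.pos) (by exact_mod_cast (hA hx).2.2)
  have hfib : ∀ b ∈ A.image f, (A.filter fun a => f a = b).card ≤ 625 := by
    intro b hb
    obtain ⟨y, hy, rfl⟩ := Finset.mem_image.1 hb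
    let P := T.filter fun p => p ∣ (radicand y.1 y.2).natAbs
    have hP : P.card ≤ 25 := by
      refine Nat.le_of_lt_succ (card_le_of_primes_dvd (n := n) (k := 13)
        (Int.natAbs_ne_zero.2 (hneg hy).ne) ?_ fun p hp => ?_)
      · have h1 := neg_radicand_le (p := y.1) (q := y.2) (n := n)
          (by exact_mod_cast (hT _ (hA hy).1).1.pos) (by exact_mod_cast (hA hy).2.2)
          (by exact_mod_cast (hT _ (hA hy).2.1).2.2)
        have h2 : 4 * 10 ^ 51 * n ^ 12 < n ^ 13 := by
          rw [pow_succ' n 12]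
          exact Nat.mul_lt_mul_of_pos_right hn (pow_pos (by omega) 12)
        have h3 : ((radicand y.1 y.2).natAbs : ℤ) = -radicand y.1 y.2 :=
          Int.ofNat_natAbs_of_nonpos (hneg hy).le
        have h4 : (radicand y.1 y.2).natAbs ≤ 4 * 10 ^ 51 * n ^ 12 := by
          rw [← h3] at h1
          exact_mod_cast h1
        exact h4.trans_lt h2
      · rw [Finset.mem_filter] at hp
        exact ⟨(hT p hp.1).1, (hT p hp.1).2.1, hp.2⟩
    have hsub : (A.filter fun a => f a = f y) ⊆ P ×ˢ P := by
      intro x hx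
      rw [Finset.mem_filter] at hx
      obtain ⟨hxA, hxy⟩ := hx
      obtain ⟨h1, h2, h3⟩ := hA hxA
      obtain ⟨d1, d2⟩ := dvd_of_isSquare_radicand_mul (hT _ h1).1 (hT _ h2).1 h3.ne
        (hbad.trans_lt (hT _ h1).2.1) (hbad.trans_lt (hT _ h2).2.1)
        (isSquare_of_imQuad_eq (hneg hxA) (hneg hy) hxy)
      rw [Finset.mem_product, Finset.mem_filter, Finset.mem_filter]
      exact ⟨⟨h1, Int.natCast_dvd.1 d1⟩, h2, Int.natCast_dvd.1 d2⟩
    calc _ ≤ (P ×ˢ P).card := Finset.card_le_card hsub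
      _ = P.card * P.card := Finset.card_product _ _
      _ ≤ 25 * 25 := Nat.mul_le_mul hP hP
  refine ⟨A.image f, fun K hK => ?_, ?_⟩
  · obtain ⟨x, hx, rfl⟩ := Finset.mem_image.1 hK
    exact ⟨x.1, (hA hx).1, x.2, (hA hx).2.1, (hA hx).2.2, rfl⟩
  · have h1 : A.card ≤ 625 * (A.image f).card := Finset.card_le_mul_card_image A 625 hfib
    have h2 : T.card * T.card ≤ 2 * A.card + T.card := card_offDiag_le T
    omega

open Filter in
lemma eventually_rpow_le_primeCounting :
    ∀ᶠ n : ℕ in atTop, (n : ℝ) ^ (4 / 5 : ℝ) ≤ Nat.primeCounting n := by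
  have h1 : ∀ᶠ x : ℝ in atTop, x ^ (4 / 5 : ℝ) * Real.log x + Real.log (x + 1) ≤
      x * Real.log 2 := by
    have hl := (isLittleO_log_rpow_atTop (r := 1 / 5) (by norm_num)).bound
      (show (0 : ℝ) < 1 / 10 by norm_num)
    filter_upwards [hl, eventually_ge_atTop 2] with x hx hx2
    have hx0 : 0 < x := by linarith
    have hlog : 0 ≤ Real.log x := Real.log_nonneg (by linarith)
    rw [Real.norm_of_nonneg hlog, Real.norm_of_nonneg (by positivity)] at hx
    have e1 : x ^ (4 / 5 : ℝ) * x ^ (1 / 5 : ℝ) = x := by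
      rw [← Real.rpow_add hx0]
      norm_num
    have e2 : x ^ (1 / 5 : ℝ) ≤ x := Real.rpow_le_self_of_one_le (by linarith) (by norm_num)
    have e3 : x ^ (4 / 5 : ℝ) * Real.log x ≤ 1 / 10 * x := by
      calc _ ≤ x ^ (4 / 5 : ℝ) * (1 / 10 * x ^ (1 / 5 : ℝ)) := by gcongr
        _ = 1 / 10 * (x ^ (4 / 5 : ℝ) * x ^ (1 / 5 : ℝ)) := by ring
        _ = _ := by rw [e1]
    have e4 : Real.log (x + 1) ≤ 2 * Real.log x := by
      rw [← Real.log_rpow hx0]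
      apply Real.log_le_log (by linarith)
      norm_num
      nlinarith
    have := Real.log_two_gt_d9
    nlinarith
  filter_upwards [tendsto_natCast_atTop_atTop.eventually h1, eventually_ge_atTop 2] with n hn hn2
  refine le_trans ?_ (Chebyshev.pi_ge n)
  rw [le_div_iff₀ (Real.log_pos (by exact_mod_cast hn2))]
  linarith

open Filter in
lemma eventually_rpow_add_one_le_sub (M : ℝ) (hM : 0 < M) :
    ∀ᶠ x : ℝ in atTop, M * (x ^ (7 / 10 : ℝ) + 1) ≤ x ^ (4 / 5 : ℝ) - x ^ (1 / 2 : ℝ) := by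
  have ht := (tendsto_rpow_atTop (y := 1 / 10) (by norm_num)).eventually_ge_atTop (2 * M + 1)
  filter_upwards [ht, eventually_ge_atTop 1] with x hx hx1
  have hx0 : 0 < x := by linarith
  have e1 : x ^ (4 / 5 : ℝ) = x ^ (7 / 10 : ℝ) * x ^ (1 / 10 : ℝ) := by
    rw [← Real.rpow_add hx0]
    norm_num
  have e2 : x ^ (1 / 2 : ℝ) ≤ x ^ (7 / 10 : ℝ) := Real.rpow_le_rpow_of_exponent_le hx1 (by norm_num)
  have e3 : 1 ≤ x ^ (7 / 10 : ℝ) := Real.one_le_rpow hx1 (by norm_num)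
  rw [e1]
  nlinarith

open Filter in
lemma eventually_mul_rpow_le :
    ∀ᶠ x : ℝ in atTop, 1250 * (x + 1) ^ (13 / 11 : ℝ) ≤ (x ^ (7 / 10 : ℝ)) ^ 2 := by
  have ht := (tendsto_rpow_atTop (y := 12 / 55) (by norm_num)).eventually_ge_atTop
    (1250 * 2 ^ (13 / 11 : ℝ))
  filter_upwards [ht, eventually_ge_atTop 1] with x hx hx1
  have hx0 : 0 < x := by linarith
  have e1 : (x ^ (7 / 10 : ℝ)) ^ 2 = x ^ (12 / 55 : ℝ) * x ^ (13 / 11 : ℝ) := by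
    rw [← Real.rpow_add hx0, ← Real.rpow_mul_natCast hx0.le]
    norm_num
  calc 1250 * (x + 1) ^ (13 / 11 : ℝ) ≤ 1250 * (2 * x) ^ (13 / 11 : ℝ) := by
        gcongr
        linarith
    _ = 1250 * 2 ^ (13 / 11 : ℝ) * x ^ (13 / 11 : ℝ) := by
        rw [Real.mul_rpow (by norm_num) hx0.le, mul_assoc]
    _ ≤ _ := by
        rw [e1]
        gcongr

open Filter in
/-- There are many primes between `√n` and `n` in some residue class modulo `M`. -/
lemma eventually_exists_primes {M : ℕ} (hM : 0 < M) :
    ∀ᶠ n : ℕ in atTop, ∃ (r : ℕ) (T : Finset ℕ),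
      (∀ p ∈ T, p.Prime ∧ n.sqrt < p ∧ p ≤ n) ∧ (∀ p ∈ T, p % M = r) ∧
      (n : ℝ) ^ (7 / 10 : ℝ) + 1 ≤ T.card := by
  filter_upwards [eventually_rpow_le_primeCounting, tendsto_natCast_atTop_atTop.eventually
    (eventually_rpow_add_one_le_sub M (by exact_mod_cast hM))] with n h1 h2
  let T₀ := (Nat.primesLE n).filter fun p => n.sqrt < p
  have hT₀ : (n.primeCounting : ℝ) ≤ T₀.card + n.sqrt := by
    have e1 := (Nat.primesLE n).card_filter_add_card_filter_not (fun p => n.sqrt < p)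
    have e2 : ((Nat.primesLE n).filter fun p => ¬ n.sqrt < p).card ≤
        (Finset.Icc 1 n.sqrt).card := by
      refine Finset.card_le_card fun p hp => ?_
      rw [Finset.mem_filter, Nat.mem_primesLE] at hp
      rw [Finset.mem_Icc]
      exact ⟨hp.1.2.pos, not_lt.1 hp.2⟩
    rw [Nat.card_Icc, Nat.add_sub_cancel] at e2
    rw [Nat.primesLE_card_eq_primeCounting] at e1
    have : n.primeCounting ≤ T₀.card + n.sqrt := by
      simp only [T₀]
      omega
    exact_mod_cast this
  have hsqrt : (n.sqrt : ℝ) ≤ (n : ℝ) ^ (1 / 2 : ℝ) := by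
    rw [← Real.sqrt_eq_rpow]
    exact Real.nat_sqrt_le_real_sqrt
  obtain ⟨r, -, hr⟩ := Finset.exists_le_card_fiber_of_nsmul_le_card_of_maps_to (s := T₀)
    (t := Finset.range M) (f := fun p => p % M) (b := (n : ℝ) ^ (7 / 10 : ℝ) + 1)
    (fun p _ => Finset.mem_range.2 (Nat.mod_lt p hM)) (Finset.nonempty_range_iff.2 hM.ne') (by
      rw [Finset.card_range, nsmul_eq_mul]
      linarith)
  refine ⟨r, _, fun p hp => ?_, fun p hp => ?_, hr⟩
  · simp only [T₀, Finset.mem_filter, Nat.mem_primesLE] at hp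
    exact ⟨hp.1.1.2, hp.1.2, hp.1.1.1⟩
  · exact (Finset.mem_filter.1 hp).2

open Filter in
lemma eventually_exists_fields :
    ∀ᶠ n : ℕ in atTop, ∃ S : Finset (Subfield ℂ),
      (∀ K ∈ S, ∃ F : ℤ, F < 0 ∧ K = imQuad F ∧ 4 * |F| < (n : ℤ) ^ 13 ∧
        ∀ [NumberField K], ∃ f : (Fin 3 → ZMod 5) →+ Additive (ClassGroup (𝓞 K)),
          Function.Injective f) ∧
      ((n : ℝ) + 1) ^ (13 / 11 : ℝ) ≤ S.card := by
  filter_upwards [eventually_exists_primes (M := badModulus) (by decide),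
    tendsto_natCast_atTop_atTop.eventually eventually_mul_rpow_le,
    eventually_gt_atTop (16 * 10 ^ 51)] with n hT h1 hn
  obtain ⟨r, T, hT, hr, hcard⟩ := hT
  obtain ⟨S, hS, hScard⟩ := exists_finset_imQuad (by omega) hT
  have hbad : badModulus ≤ n.sqrt :=
    Nat.le_sqrt.2 (le_trans (by norm_num [badModulus]) hn.le)
  refine ⟨S, fun K hK => ?_, ?_⟩
  · obtain ⟨p, hp, q, hq, hpq, rfl⟩ := hS K hK
    have hp0 : (0 : ℤ) < p := by exact_mod_cast (hT p hp).1.pos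
    have hpq' : (p : ℤ) < q := by exact_mod_cast hpq
    have hF := radicand_neg hp0 hpq'
    have hpb := hbad.trans_lt (hT p hp).2.1
    refine ⟨_, hF, rfl, ?_, ?_⟩
    · have h3 := neg_radicand_le hp0 hpq' (n := n) (by exact_mod_cast (hT q hq).2.2)
      have h4 : (16 * 10 ^ 51 * n ^ 12 : ℤ) < n ^ 13 := by
        rw [pow_succ' (n : ℤ) 12]
        have : (16 * 10 ^ 51 : ℤ) < n := by exact_mod_cast hn
        exact mul_lt_mul_of_pos_right this (by positivity)
      rw [abs_of_neg hF]
      linarith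
    · intro _
      refine exists_injective_radicand hF ?_ ?_ (isCoprime_params (hT p hp).1 (hT q hq).1 hpq.ne
        hpb (hbad.trans_lt (hT q hq).2.1))
      · refine Nat.isCoprime_iff_coprime.2 (((hT p hp).1.coprime_iff_not_dvd).2 fun h => ?_)
        have := Nat.le_of_dvd (by decide) h
        omega
      · exact Int.natCast_modEq_iff.2 ((hr q hq).trans (hr p hp).symm)
  · have h2 : (T.card : ℝ) * T.card ≤ 1250 * S.card + T.card := by exact_mod_cast hScard
    have h3 : (0 : ℝ) ≤ (n : ℝ) ^ (7 / 10 : ℝ) := by positivity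
    have h4 : ((n : ℝ) ^ (7 / 10 : ℝ)) ^ 2 ≤ T.card * T.card - T.card := by nlinarith
    linarith

/-- There are `≫ X^(1/11)/log X` imaginary quadratic fields `k` with `|Disc(k)| < X` and `rank_5 Cl(k) ≥ 3`. -/
theorem mestre_imaginary_quantitative  :
    ∃ c : ℝ, 0 < c ∧ ∃ X₀ : ℝ, ∀ X : ℝ, X₀ ≤ X →
      ∃ S : Finset (Subfield ℂ),
        -- the fields in `S` are pairwise non-isomorphic
        (∀ K ∈ S, ∀ L ∈ S, Nonempty (↥K ≃+* ↥L) → K = L) ∧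
        (∀ K ∈ S,
          -- `K` is a quadratic field of the prescribed signature
          Module.finrank ℚ ↥K = 2 ∧
          (∀ φ : ↥K →+* ℂ, ∃ a : ↥K, (φ a).im ≠ 0) ∧
          NumberField ↥K ∧
          (∀ [NumberField ↥K],
            -- `|Disc K| < X`
            |(NumberField.discr ↥K : ℝ)| < X ∧
            -- the `m`-rank condition on the class group
            ∃ f : (Fin 3 → ZMod 5) →+ Additive (ClassGroup (𝓞 ↥K)), Function.Injective f)) ∧
        c * X ^ ((1 : ℝ) / 11) / Real.log X ≤ S.card := by
  obtain ⟨n₀, hn₀⟩ := Filter.eventually_atTop.1 eventually_exists_fields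
  refine ⟨1, one_pos, max (Real.exp 1) (n₀ ^ 13), fun X hX => ?_⟩
  have hXe : Real.exp 1 ≤ X := (le_max_left _ _).trans hX
  have hX0 : 0 < X := (Real.exp_pos 1).trans_le hXe
  let n := ⌊X ^ (1 / 13 : ℝ)⌋₊
  have hpow : (X ^ (1 / 13 : ℝ)) ^ 13 = X := by
    rw [← Real.rpow_mul_natCast hX0.le]
    norm_num
  have hn1 : (n : ℝ) ^ 13 ≤ X := by
    calc (n : ℝ) ^ 13 ≤ (X ^ (1 / 13 : ℝ)) ^ 13 := by
          gcongr
          exact Nat.floor_le (by positivity)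
      _ = X := hpow
  have hn2 : X ^ (1 / 11 : ℝ) ≤ ((n : ℝ) + 1) ^ (13 / 11 : ℝ) := by
    calc X ^ (1 / 11 : ℝ) = (X ^ (1 / 13 : ℝ)) ^ (13 / 11 : ℝ) := by
          rw [← Real.rpow_mul hX0.le]
          norm_num
      _ ≤ _ := by
          gcongr
          exact (Nat.lt_floor_add_one _).le
  have hnn : n₀ ≤ n := by
    refine Nat.le_floor ?_
    refine le_of_pow_le_pow_left₀ (n := 13) (by norm_num) (by positivity) ?_
    rw [hpow]
    exact (le_max_right _ _).trans hX
  obtain ⟨S, hS, hcard⟩ := hn₀ n hnn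
  refine ⟨S, ?_, ?_, ?_⟩
  · rintro K hK L hL ⟨φ⟩
    obtain ⟨F, hF, rfl, -⟩ := hS K hK
    obtain ⟨G, hG, rfl, -⟩ := hS L hL
    exact imQuad_eq_of_ringEquiv hF hG φ
  · intro K hK
    obtain ⟨F, hF, rfl, hFn, hf⟩ := hS K hK
    refine ⟨finrank_imQuad hF, exists_im_ne_zero hF, numberField_imQuad hF, ?_⟩
    intro _
    refine ⟨lt_of_lt_of_le ?_ hn1, hf⟩
    exact_mod_cast (abs_discr_imQuad_le hF).trans_lt hFn
  · have hlog : 1 ≤ Real.log X := by rwa [Real.le_log_iff_exp_le hX0]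
    calc 1 * X ^ ((1 : ℝ) / 11) / Real.log X ≤ X ^ ((1 : ℝ) / 11) := by
          rw [one_mul]
          exact div_le_self (by positivity) hlog
      _ ≤ _ := hn2.trans hcard
end

section
/- Let m, d > 1 be integers with d > (m−1)². Let r be the largest positive integer such that r − ⌊r/m⌋ ≤ d and gcd(r, m) = 1. Then r ≥ d + d/(m−1) − m + 1, i.e. (m−1)·r ≥ (m−1)(d − m + 1) + d. -/
/-- Let `m, d > 1` with `d > (m−1)²`, and let `r` be the largest positive
integer such that `r − ⌊r/m⌋ ≤ d` and `gcd(r, m) = 1`. Then `r ≥ d + d/(m−1) − m + 1`, i.e.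
`(m−1)·r ≥ (m−1)(d − m + 1) + d`. -/
theorem largest_r_lower_bound (m d r : ℕ) (hm : 1 < m) (hd : 1 < d)
    (hdm : (m - 1) ^ 2 < d)
    (hr : 0 < r) (hr1 : r - r / m ≤ d) (hr2 : Nat.gcd r m = 1)
    (hmax : ∀ r' : ℕ, 0 < r' → r' - r' / m ≤ d → Nat.gcd r' m = 1 → r' ≤ r) :
    ((m : ℤ) - 1) * r ≥ ((m : ℤ) - 1) * ((d : ℤ) - m + 1) + d := by
  obtain ⟨n, rfl⟩ : ∃ n, m = n + 1 := ⟨m - 1, by omega⟩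
  have hn : 0 < n := by omega
  have hdiv := Nat.div_add_mod (d - 1) n
  have hmod := Nat.mod_lt (d - 1) hn
  set k := (d - 1) / n
  set u := (d - 1) % n
  have hd' : d = n * k + u + 1 := by omega
  have hq : ((n + 1) * k + 1) / (n + 1) = k := by
    rw [Nat.mul_add_div (by omega), Nat.div_eq_of_lt (by omega), add_zero]
  have hle : (n + 1) * k + 1 ≤ r := by
    refine hmax _ (by omega) ?_ (by simp)
    rw [hq, add_mul]
    omega
  have hle' : ((n : ℤ) + 1) * k + 1 ≤ r := by exact_mod_cast hle
  have hu : (u : ℤ) + 1 ≤ n := by exact_mod_cast hmod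
  have h₁ := mul_le_mul_of_nonneg_left hle' (Int.natCast_nonneg n)
  have h₂ := mul_le_mul_of_nonneg_left hu (by positivity : (0 : ℤ) ≤ n + 1)
  rw [hd']
  push_cast
  linarith
end

section
/- Let d > 1 and m > 1 be integers with m dividing d. Then rank_m Cl(k) is unbounded as k runs through number fields of degree [k:ℚ] = d: for every integer r ≥ 1 there exists a number field k with [k:ℚ] = d and rank_m Cl(k) ≥ r. -/
open NumberField

theorem trace_eq_zero_of_pow_mem_range {K : Type*} [Field K] [NumberField K] (φ : K →+* ℝ)
    {γ : K} {N : ℕ} (hN : N ≠ 0) {c : ℚ} (hc : γ ^ N = algebraMap ℚ K c)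
    (hγ : γ ∉ (algebraMap ℚ K).range) : Algebra.trace ℚ K γ = 0 := by
  have hint : IsIntegral ℚ γ := Algebra.IsIntegral.isIntegral γ
  set s := (minpoly ℚ γ).natDegree with hs
  have hs1 : s ≠ 1 := fun h => hγ ((minpoly.natDegree_eq_one_iff).1 h)
  have hs0 : s ≠ 0 := (minpoly.natDegree_pos hint).ne'
  obtain ⟨q, hq⟩ : ∃ q : ℚ, γ ^ s = algebraMap ℚ K q := by
    set g := IntermediateField.AdjoinSimple.gen ℚ γ
    have hg : g ^ N = algebraMap ℚ _ c := by
      apply Subtype.ext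
      simpa [g] using hc
    have hn := congrArg (Algebra.norm ℚ) hg
    rw [map_pow, Algebra.norm_algebraMap, IntermediateField.adjoin.finrank hint, ← hs] at hn
    set ν := Algebra.norm ℚ g
    have hφ : φ γ ^ N = c := by rw [← map_pow, hc]; simp
    have habs : |φ γ ^ s| = |(ν : ℝ)| := by
      refine (pow_left_inj₀ (abs_nonneg _) (abs_nonneg _) hN).1 ?_
      rw [← abs_pow, ← abs_pow, ← pow_mul, mul_comm, pow_mul, hφ]
      exact_mod_cast congrArg abs hn.symm
    rcases abs_eq_abs.1 habs with h | h
    · exact ⟨ν, φ.injective (by simpa using h)⟩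
    · exact ⟨-ν, φ.injective (by simpa using h)⟩
  have hmin : Polynomial.X ^ s - Polynomial.C q = minpoly ℚ γ := by
    refine Polynomial.eq_of_monic_of_dvd_of_natDegree_le (minpoly.monic hint)
      (Polynomial.monic_X_pow_sub_C q hs0) (minpoly.dvd _ _ (by simp [hq])) ?_
    rw [Polynomial.natDegree_X_pow_sub_C]
  rw [trace_eq_finrank_mul_minpoly_nextCoeff, ← hmin,
    Polynomial.nextCoeff_of_natDegree_pos (by rw [Polynomial.natDegree_X_pow_sub_C]; omega),
    Polynomial.natDegree_X_pow_sub_C, Polynomial.coeff_sub, Polynomial.coeff_X_pow,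
    Polynomial.coeff_C, if_neg (by omega), if_neg (by omega)]
  simp

theorem linearIndependent_of_div_pow_mem_range {K S : Type*} [Field K] [NumberField K]
    (φ : K →+* ℝ) {γ : S → K} {N : ℕ} (hN : N ≠ 0) (h0 : ∀ s, γ s ≠ 0)
    (hpow : ∀ s t, (γ s / γ t) ^ N ∈ (algebraMap ℚ K).range)
    (hrat : ∀ s t, s ≠ t → γ s / γ t ∉ (algebraMap ℚ K).range) : LinearIndependent ℚ γ := by
  classical
  rw [linearIndependent_iff']
  intro F g hg t ht
  have h : ∑ s ∈ F, g s • (γ s / γ t) = 0 := by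
    simp_rw [div_eq_mul_inv, ← smul_mul_assoc, ← Finset.sum_mul, hg, zero_mul]
  have h2 := congrArg (Algebra.trace ℚ K) h
  rw [map_sum, Finset.sum_eq_single_of_mem t ht, map_smul, div_self (h0 t),
    ← map_one (algebraMap ℚ K), Algebra.trace_algebraMap] at h2
  · simpa [Module.finrank_pos.ne'] using h2
  · intro s _ hst
    obtain ⟨c, hc⟩ := hpow s t
    rw [map_smul, trace_eq_zero_of_pow_mem_range φ hN hc.symm (hrat s t hst), smul_zero]

theorem exists_injective_of_card_ker_le {A : Type*} [AddCommGroup A] {m n r : ℕ}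
    (f : (Fin n → ZMod m) →+ A) [Finite f.ker] (h : r + Nat.card f.ker ≤ n) :
    ∃ g : (Fin r → ZMod m) →+ A, Function.Injective g := by
  classical
  have := Fintype.ofFinite f.ker
  have hpos : 0 < Nat.card f.ker := Nat.card_pos
  have hne : ∀ x : f.ker, ∃ i, x ≠ 0 → x.1 i ≠ 0 := by
    intro x
    by_cases hx : x = 0
    · exact ⟨⟨0, by omega⟩, fun h => absurd hx h⟩
    · obtain ⟨i, hi⟩ := Function.ne_iff.1 (fun h => hx (Subtype.ext h) : x.1 ≠ 0)
      exact ⟨i, fun _ => hi⟩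
  choose ι hι using hne
  have hT : (Finset.univ.image ι).card ≤ Nat.card f.ker := by
    rw [Nat.card_eq_fintype_card]
    exact Finset.card_image_le
  obtain ⟨j, hj⟩ : ∃ j : Fin r ↪ Fin n, ∀ k, j k ∉ Finset.univ.image ι := by
    have hc : Fintype.card (Fin r) ≤ Fintype.card ↥(Finset.univ.image ι)ᶜ := by
      rw [Fintype.card_coe, Finset.card_compl, Fintype.card_fin, Fintype.card_fin]
      omega
    obtain ⟨j⟩ := Function.Embedding.nonempty_of_card_le hc
    exact ⟨j.trans (Function.Embedding.subtype _), fun k => Finset.mem_compl.1 (j k).2⟩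
  refine ⟨f.comp (Function.ExtendByZero.hom (ZMod m) j), ?_⟩
  rw [injective_iff_map_eq_zero]
  intro e he
  set x : f.ker := ⟨Function.extend j e 0, he⟩ with hx
  have hx0 : x = 0 := by
    by_contra hx0
    refine hι x hx0 (Function.extend_apply' _ _ _ ?_)
    rintro ⟨k, hk⟩
    exact hj k (hk ▸ Finset.mem_image_of_mem ι (Finset.mem_univ x))
  funext k
  rw [← j.injective.extend_apply e 0 k]
  exact congrFun (congrArg Subtype.val hx0) (j k)

theorem Ideal.pow_span_sup_span_eq {R : Type*} [CommRing R] {p d D : ℕ} {α : R}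
    (hα : α ^ d = D) (hg : Nat.gcd (p ^ d) D = p) :
    (Ideal.span {(p : R)} ⊔ Ideal.span {α}) ^ d = Ideal.span {(p : R)} := by
  apply le_antisymm
  · rw [← Submodule.add_eq_sup, add_pow, Ideal.sum_eq_sup]
    refine Finset.sup_le fun j _ => Ideal.mul_le_left.trans ?_
    rcases eq_or_ne j 0 with rfl | hj0
    · rw [pow_zero, one_mul, Nat.sub_zero, Ideal.span_singleton_pow, hα,
        Ideal.span_singleton_le_span_singleton]
      exact Nat.cast_dvd_cast (hg ▸ Nat.gcd_dvd_right (p ^ d) D)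
    · exact Ideal.mul_le_left.trans (Ideal.pow_le_self hj0)
  · rw [Ideal.span_singleton_le_iff_mem]
    have hb := congrArg (Int.cast : ℤ → R) (Nat.gcd_eq_gcd_ab (p ^ d) D)
    rw [hg] at hb
    push_cast at hb
    have hp : (p : R) ∈ Ideal.span {(p : R)} ⊔ Ideal.span {α} :=
      Ideal.mem_sup_left (Ideal.mem_span_singleton_self _)
    have ha : α ∈ Ideal.span {(p : R)} ⊔ Ideal.span {α} :=
      Ideal.mem_sup_right (Ideal.mem_span_singleton_self _)
    have hD := hα ▸ Ideal.pow_mem_pow ha d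
    have key := add_mem
      (Ideal.mul_mem_right (((p ^ d).gcdA D : ℤ) : R) _ (Ideal.pow_mem_pow hp d))
      (Ideal.mul_mem_right (((p ^ d).gcdB D : ℤ) : R) _ hD)
    rwa [← hb] at key

theorem padicValRat_prod_pow {n : ℕ} {p : Fin n → ℕ} (hp : ∀ i, (p i).Prime)
    (hinj : Function.Injective p) (e : Fin n → ℕ) (i : Fin n) :
    padicValRat (p i) (∏ j, (p j : ℚ) ^ e j) = e i := by
  have : (∏ j, (p j : ℚ) ^ e j) = ((∏ j, p j ^ e j : ℕ) : ℚ) := by push_cast; rfl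
  rw [this, padicValRat.of_nat, ← Nat.factorization_def _ (hp i),
    Nat.factorization_prod fun j _ => pow_ne_zero _ (hp j).ne_zero, Finset.sum_apply',
    Finset.sum_eq_single i]
  · simp [(hp i).factorization_pow]
  · intro j _ hj
    simp [(hp j).factorization_pow, hinj.ne hj]
  · simp

theorem eq_of_pow_eq_prod_pow {n m t : ℕ} (ht : t ≠ 0) [NeZero m] {p : Fin n → ℕ}
    (hp : ∀ i, (p i).Prime) (hinj : Function.Injective p) {e e' : Fin n → ZMod m} {q : ℚ}
    (h : q ^ (m * t) = ((∏ j, (p j : ℚ) ^ (e j).val) / ∏ j, (p j : ℚ) ^ (e' j).val) ^ t) :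
    e = e' := by
  funext i
  have : Fact (p i).Prime := ⟨hp i⟩
  have hP (f : Fin n → ZMod m) : (∏ j, (p j : ℚ) ^ (f j).val) ≠ 0 :=
    Finset.prod_ne_zero_iff.2 fun j _ => pow_ne_zero _ (by exact_mod_cast (hp j).ne_zero)
  have hq : q ≠ 0 := by
    rintro rfl
    rw [zero_pow (mul_ne_zero (NeZero.ne m) ht)] at h
    exact pow_ne_zero t (div_ne_zero (hP e) (hP e')) h.symm
  have hv := congrArg (padicValRat (p i)) h
  rw [padicValRat.pow, padicValRat.pow,
    padicValRat.div (hP e) (hP e'), padicValRat_prod_pow hp hinj (fun j => (e j).val),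
    padicValRat_prod_pow hp hinj (fun j => (e' j).val)] at hv
  push_cast at hv
  have hv' : (m : ℤ) * padicValRat (p i) q = (e i).val - (e' i).val :=
    mul_left_cancel₀ (Nat.cast_ne_zero.2 ht : (t : ℤ) ≠ 0) (by linear_combination hv)
  have hz := congrArg (Int.cast : ℤ → ZMod m) hv'
  push_cast at hz
  simp only [CharP.cast_eq_zero, zero_mul, ZMod.natCast_val, ZMod.cast_id', id] at hz
  exact sub_eq_zero.1 hz.symm

theorem NumberField.Units.rank_lt_finrank (K : Type*) [Field K] [NumberField K] :
    Units.rank K < Module.finrank ℚ K := by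
  have h1 := InfinitePlace.card_add_two_mul_card_eq_rank K
  have h2 := InfinitePlace.card_eq_nrRealPlaces_add_nrComplexPlaces K
  have h3 : 0 < Module.finrank ℚ K := Module.finrank_pos
  rw [Units.rank]
  omega

theorem card_isPrincipal_prod_pow_le {K : Type*} [Field K] [NumberField K] (φ : K →+* ℝ)
    {m n : ℕ} [NeZero m] {p : Fin n → ℕ} (hp : ∀ i, (p i).Prime) (hinj : Function.Injective p)
    {Q : Fin n → Ideal (𝓞 K)} (hQ : ∀ i, Q i ^ m = Ideal.span {(p i : 𝓞 K)}) :
    Nat.card {e : Fin n → ZMod m // (∏ i, Q i ^ (e i).val).IsPrincipal} ≤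
      Module.finrank ℚ K * m ^ Units.rank K := by
  classical
  set H := {e : Fin n → ZMod m // (∏ i, Q i ^ (e i).val).IsPrincipal}
  have hex : ∀ e : H, ∃ (γ : K) (ζ : K) (k : Fin (Units.rank K) → ℤ),
      ζ ≠ 0 ∧ ζ ^ Units.torsionOrder K = 1 ∧
      γ ^ m * ζ * ∏ i, ((Units.fundSystem K i : 𝓞 K) : K) ^ (k i % m) =
        algebraMap ℚ K (∏ i, (p i : ℚ) ^ (e.1 i).val) := by
    intro e
    obtain ⟨β, hβ⟩ := e.2.principal
    have h1 : Ideal.span {β ^ m} = Ideal.span {∏ i, (p i : 𝓞 K) ^ (e.1 i).val} := by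
      rw [← Ideal.span_singleton_pow]
      change Submodule.span (𝓞 K) {β} ^ m = _
      rw [← hβ]
      simp_rw [← Finset.prod_pow, ← pow_mul, mul_comm _ m, pow_mul, hQ, Ideal.span_singleton_pow,
        Ideal.prod_span_singleton]
    obtain ⟨u, hu⟩ := Ideal.span_singleton_eq_span_singleton.1 h1
    obtain ⟨⟨ζ, k⟩, hk, -⟩ := Units.exist_unique_eq_mul_prod K u
    refine ⟨β * ∏ i, ((Units.fundSystem K i : 𝓞 K) : K) ^ (k i / m), ((ζ : (𝓞 K)ˣ) : 𝓞 K), k,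
      by simp, ?_, ?_⟩
    · have := congrArg (fun u : Units.torsion K => (((u : (𝓞 K)ˣ) : 𝓞 K) : K))
        (pow_card_eq_one' (x := ζ))
      simpa only [Subgroup.coe_pow, Units.coe_pow, OneMemClass.coe_one, Units.coe_one] using! this
    · have hu' : (β : K) ^ m * ((u : 𝓞 K) : K) = ∏ i, (p i : K) ^ (e.1 i).val := by
        have := congrArg (algebraMap (𝓞 K) K) hu
        simpa using this
      have hk' : ((u : 𝓞 K) : K) = ((ζ : (𝓞 K)ˣ) : 𝓞 K) *
          ∏ i, ((Units.fundSystem K i : 𝓞 K) : K) ^ (k i) := by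
        have := congrArg (fun u : (𝓞 K)ˣ => ((u : 𝓞 K) : K)) hk
        simpa [-map_zpow₀, Units.coe_zpow] using this
      have hsplit : ∏ i, ((Units.fundSystem K i : 𝓞 K) : K) ^ (k i) =
          (∏ i, ((Units.fundSystem K i : 𝓞 K) : K) ^ (k i / m)) ^ m *
          ∏ i, ((Units.fundSystem K i : 𝓞 K) : K) ^ (k i % m) := by
        rw [← Finset.prod_pow, ← Finset.prod_mul_distrib]
        refine Finset.prod_congr rfl fun i _ => ?_
        rw [← zpow_natCast, ← zpow_mul, ← zpow_add₀ (by simp), mul_comm, Int.mul_ediv_add_emod]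
      rw [map_prod]
      simp only [map_pow, map_natCast]
      rw [← hu', hk', hsplit]
      ring
  choose γ ζ k hζ0 hζ h using hex
  have hP (e : H) : algebraMap ℚ K (∏ i, (p i : ℚ) ^ (e.1 i).val) ≠ 0 :=
    (map_ne_zero _).2 <|
      Finset.prod_ne_zero_iff.2 fun j _ => pow_ne_zero _ (by exact_mod_cast (hp j).ne_zero)
  have hγ0 (e : H) : γ e ≠ 0 := by
    intro h0
    apply hP e
    rw [← h e, h0, zero_pow (NeZero.ne m), zero_mul, zero_mul]
  have hdiv (e e' : H) (hee : ∀ i, (k e i : ZMod m) = k e' i) :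
      (γ e / γ e') ^ (m * Units.torsionOrder K) = algebraMap ℚ K
        (((∏ i, (p i : ℚ) ^ (e.1 i).val) / ∏ i, (p i : ℚ) ^ (e'.1 i).val) ^
          Units.torsionOrder K) := by
    have hk : ∀ i, k e i % m = k e' i % m := fun i => (ZMod.intCast_eq_intCast_iff _ _ _).1 (hee i)
    have hF : ∏ i, ((Units.fundSystem K i : 𝓞 K) : K) ^ (k e' i % m) ≠ 0 :=
      Finset.prod_ne_zero_iff.2 fun i _ => zpow_ne_zero _ (by simp)
    rw [map_pow, map_div₀, ← h e, ← h e']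
    simp_rw [hk]
    rw [mul_div_mul_right _ _ hF, mul_div_mul_comm, mul_pow, div_pow (ζ e), hζ, hζ, div_one, mul_one,
      ← div_pow, ← pow_mul]
  have := Fintype.ofFinite H
  have hcard := Finset.card_le_mul_card_image_of_maps_to (s := (Finset.univ : Finset H))
    (t := (Finset.univ : Finset (Fin (Units.rank K) → ZMod m)))
    (f := fun e i => (k e i : ZMod m)) (fun _ _ => Finset.mem_univ _) (Module.finrank ℚ K) ?_
  · rw [Nat.card_eq_fintype_card]
    simpa [ZMod.card] using hcard
  · intro c _
    set S := Finset.univ.filter fun e : H => (fun i => (k e i : ZMod m)) = c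
    have hS (s t : S) : ∀ i, (k s.1 i : ZMod m) = k t.1 i := fun i =>
      congrFun ((Finset.mem_filter.1 s.2).2.trans (Finset.mem_filter.1 t.2).2.symm) i
    have hlin : LinearIndependent ℚ fun s : S => γ s.1 := by
      refine linearIndependent_of_div_pow_mem_range φ
        (mul_ne_zero (NeZero.ne m) (Units.torsionOrder_ne_zero K)) (fun s => hγ0 _)
        (fun s t => ⟨_, (hdiv s t (hS s t)).symm⟩) ?_
      rintro s t hst ⟨q, hq⟩
      have hd := hdiv s t (hS s t)
      rw [← hq, ← map_pow] at hd
      exact hst (Subtype.ext (Subtype.ext (eq_of_pow_eq_prod_pow (Units.torsionOrder_ne_zero K)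
        hp hinj ((algebraMap ℚ K).injective hd))))
    simpa using hlin.fintype_card_le_finrank

theorem ZMod.exists_addMonoidHom_apply_eq_val_nsmul {A : Type*} [AddCommGroup A] {m : ℕ}
    [NeZero m] {c : A} (hc : m • c = 0) : ∃ g : ZMod m →+ A, ∀ x, g x = x.val • c := by
  have hf : zmultiplesHom A c m = 0 := by simpa using hc
  refine ⟨ZMod.lift m ⟨zmultiplesHom A c, hf⟩, fun x => ?_⟩
  have h := ZMod.lift_coe m ⟨zmultiplesHom A c, hf⟩ (x.val : ℤ)
  rw [Int.cast_natCast, ZMod.natCast_zmod_val] at h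
  rw [h, zmultiplesHom_apply, natCast_zsmul]

theorem exists_injective_classGroup_of_pow_eq_prod {K : Type*} [Field K] [NumberField K]
    (φ : K →+* ℝ) {d m n r : ℕ} [NeZero m] (hd0 : d ≠ 0) (hmd : m ∣ d) {p : Fin n → ℕ}
    (hp : ∀ i, (p i).Prime) (hinj : Function.Injective p) {α : 𝓞 K}
    (hα : α ^ d = (∏ i, p i : ℕ)) (hn : r + Module.finrank ℚ K * m ^ Units.rank K ≤ n) :
    ∃ f : (Fin r → ZMod m) →+ Additive (ClassGroup (𝓞 K)), Function.Injective f := by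
  obtain ⟨k, rfl⟩ := hmd
  set Q : Fin n → Ideal (𝓞 K) := fun i => (Ideal.span {(p i : 𝓞 K)} ⊔ Ideal.span {α}) ^ k
  have hQ (i) : Q i ^ m = Ideal.span {(p i : 𝓞 K)} := by
    rw [← pow_mul, mul_comm]
    refine Ideal.pow_span_sup_span_eq hα ?_
    obtain ⟨l, hl⟩ := Nat.exists_eq_succ_of_ne_zero hd0
    rw [← Finset.mul_prod_erase _ _ (Finset.mem_univ i), hl, pow_succ', Nat.gcd_mul_left,
      Nat.Coprime.gcd_eq_one, mul_one]
    refine Nat.Coprime.pow_left _ (Nat.Coprime.prod_right fun j hj => ?_)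
    exact (Nat.coprime_primes (hp i) (hp j)).2 (hinj.ne (Finset.ne_of_mem_erase hj).symm)
  have hQ0 (i) : Q i ∈ nonZeroDivisors (Ideal (𝓞 K)) := by
    refine mem_nonZeroDivisors_of_ne_zero fun h => ?_
    have h' := hQ i
    rw [h, zero_pow (NeZero.ne m), eq_comm, Ideal.zero_eq_bot, Ideal.span_singleton_eq_bot] at h'
    exact (hp i).ne_zero (by exact_mod_cast h')
  set C : Fin n → Additive (ClassGroup (𝓞 K)) :=
    fun i => Additive.ofMul (ClassGroup.mk0 ⟨Q i, hQ0 i⟩)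
  have hC (i) : m • C i = 0 := by
    refine Additive.toMul.injective ?_
    change ClassGroup.mk0 _ ^ m = 1
    rw [← map_pow, ClassGroup.mk0_eq_one_iff]
    exact ⟨⟨(p i : 𝓞 K), hQ i⟩⟩
  choose g hg using fun i => ZMod.exists_addMonoidHom_apply_eq_val_nsmul (hC i)
  let F : (Fin n → ZMod m) →+ Additive (ClassGroup (𝓞 K)) :=
    ∑ i, (g i).comp (Pi.evalAddMonoidHom (fun _ => ZMod m) i)
  have hF (e) : F e = ∑ i, (e i).val • C i := by
    simp only [F, AddMonoidHom.finsetSum_apply, AddMonoidHom.comp_apply,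
      Pi.evalAddMonoidHom_apply, hg]
  have hker (e) : e ∈ F.ker ↔ (∏ i, Q i ^ (e i).val).IsPrincipal := by
    have : F e = Additive.ofMul (ClassGroup.mk0 (∏ i, ⟨Q i, hQ0 i⟩ ^ (e i).val)) := by
      rw [hF, map_prod, ofMul_prod]
      simp only [map_pow, ofMul_pow, C]
    rw [AddMonoidHom.mem_ker, this, ofMul_eq_zero, ClassGroup.mk0_eq_one_iff]
    simp
  refine exists_injective_of_card_ker_le F (le_trans (Nat.add_le_add_left ?_ r) hn)
  rw [Nat.card_congr (Equiv.subtypeEquivRight hker)]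
  exact card_isPrincipal_prod_pow_le φ hp hinj hQ

theorem irreducible_X_pow_sub_C_prod_primes {n d : ℕ} (hd : d ≠ 0) (hn : n ≠ 0) {p : Fin n → ℕ}
    (hp : ∀ i, (p i).Prime) (hinj : Function.Injective p) :
    Irreducible (Polynomial.X ^ d - Polynomial.C ((∏ i, p i : ℕ) : ℚ)) := by
  have hmon := Polynomial.monic_X_pow_sub_C (((∏ i, p i : ℕ) : ℤ)) hd
  have hirr : Irreducible (Polynomial.X ^ d - Polynomial.C (((∏ i, p i : ℕ) : ℤ))) := by
    set i : Fin n := ⟨0, Nat.pos_of_ne_zero hn⟩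
    have hpi : Prime (p i : ℤ) := Nat.prime_iff_prime_int.1 (hp i)
    have hP : (Ideal.span {(p i : ℤ)}).IsPrime :=
      (Ideal.span_singleton_prime hpi.ne_zero).2 hpi
    refine Polynomial.IsEisensteinAt.irreducible (𝓟 := Ideal.span {(p i : ℤ)}) ?_ hP
      hmon.isPrimitive (by rw [Polynomial.natDegree_X_pow_sub_C]; omega)
    refine hmon.isEisensteinAt_of_mem_of_notMem hP.ne_top ?_ ?_
    · intro l hl
      rw [Polynomial.natDegree_X_pow_sub_C] at hl
      rw [Polynomial.coeff_sub, Polynomial.coeff_X_pow, if_neg hl.ne, Polynomial.coeff_C, zero_sub,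
        neg_mem_iff]
      split_ifs
      · rw [Ideal.mem_span_singleton]
        exact_mod_cast Finset.dvd_prod_of_mem p (Finset.mem_univ i)
      · exact zero_mem _
    · rw [Polynomial.coeff_sub, Polynomial.coeff_X_pow, if_neg hd.symm, Polynomial.coeff_C_zero,
        zero_sub, neg_mem_iff, Ideal.span_singleton_pow, Ideal.mem_span_singleton]
      norm_cast
      rw [← Finset.mul_prod_erase _ _ (Finset.mem_univ i), pow_two,
        mul_dvd_mul_iff_left (hp i).ne_zero, (hp i).prime.dvd_finsetProd_iff]
      rintro ⟨j, hj, h⟩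
      exact Finset.ne_of_mem_erase hj (hinj ((Nat.prime_dvd_prime_iff_eq (hp i) (hp j)).1 h)).symm
  simpa [Polynomial.map_prod] using (Polynomial.IsPrimitive.Int.irreducible_iff_irreducible_map_cast
    hmon.isPrimitive).1 hirr

/-- Let `d > 1` and `m > 1` with `m ∣ d`. Then `rank_m Cl(k)` is unbounded
among number fields `k` of degree `d`: for every `r ≥ 1` there is a number field `k` of degree
`d` with `rank_m Cl(k) ≥ r`. -/
theorem unbounded_rank_of_dvd (m d : ℕ) (hm : 1 < m) (hd : 1 < d) (hmd : m ∣ d)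
    (r : ℕ) (hr : 1 ≤ r) :
    ∃ K : Subfield ℂ, NumberField ↥K ∧ Module.finrank ℚ ↥K = d ∧
      ∃ f : (Fin r → ZMod m) →+ Additive (ClassGroup (𝓞 ↥K)), Function.Injective f := by
  have : NeZero m := ⟨by omega⟩
  have hd0 : d ≠ 0 := by omega
  set n := r + d * m ^ d
  set p : Fin n → ℕ := fun i => Nat.nth Nat.Prime i
  have hp (i) : (p i).Prime := Nat.prime_nth_prime i
  have hinj : Function.Injective p := fun i j h =>
    Fin.ext (Nat.nth_injective Nat.infinite_setOfPred_prime h)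
  have hirr := irreducible_X_pow_sub_C_prod_primes hd0 (by omega : n ≠ 0) hp hinj
  obtain ⟨a, ha⟩ : ∃ a : ℝ, a ^ d = (∏ i, p i : ℕ) :=
    ⟨_, Real.rpow_inv_natCast_pow (Nat.cast_nonneg _) hd0⟩
  have hint : IsIntegral ℚ a := ⟨_, Polynomial.monic_X_pow_sub_C ((∏ i, p i : ℕ) : ℚ) hd0, by
    simp [-Nat.cast_prod, Polynomial.eval₂_sub, ha]⟩
  have hmin : Polynomial.X ^ d - Polynomial.C ((∏ i, p i : ℕ) : ℚ) = minpoly ℚ a :=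
    minpoly.eq_of_irreducible_of_monic hirr (by simp [ha]) (Polynomial.monic_X_pow_sub_C _ hd0)
  set L := IntermediateField.adjoin ℚ {a}
  have hfin : Module.finrank ℚ L = d := by
    rw [IntermediateField.adjoin.finrank hint, ← hmin, Polynomial.natDegree_X_pow_sub_C]
  have : FiniteDimensional ℚ L := IntermediateField.adjoin.finiteDimensional hint
  let K : Subfield ℂ := L.toSubfield.map Complex.ofRealHom
  let E : L ≃+* K := L.toSubfield.equivMapOfInjective _ Complex.ofRealHom.injective
  let E' : L ≃ₗ[ℚ] K := { E with map_smul' := fun q x => map_rat_smul E q x }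
  have hK : NumberField K := { to_finiteDimensional := E'.finiteDimensional }
  have hKfin : Module.finrank ℚ K = d := E'.finrank_eq ▸ hfin
  refine ⟨K, hK, hKfin, ?_⟩
  let b : K := E ⟨a, IntermediateField.mem_adjoin_simple_self ℚ a⟩
  have hb : b ^ d = (∏ i, p i : ℕ) := by
    rw [← map_pow, ← map_natCast E]
    congr 1
    exact Subtype.ext (by simpa using ha)
  have hbint : IsIntegral ℤ b := IsIntegral.of_pow (Nat.pos_of_ne_zero hd0) 
    (hb ▸ isIntegral_natCast _)
  obtain ⟨β, hβ⟩ := IsIntegralClosure.isIntegral_iff (A := 𝓞 K) |>.1 hbint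
  refine exists_injective_classGroup_of_pow_eq_prod (L.val.toRingHom.comp E.symm.toRingHom) hd0 hmd
    hp hinj (α := β)
    (RingOfIntegers.coe_injective (by rw [map_natCast, map_pow, hβ, hb])) ?_
  rw [hKfin]
  exact Nat.add_le_add_left (Nat.mul_le_mul_left _ (Nat.pow_le_pow_right (by omega)
    (hKfin ▸ (Units.rank_lt_finrank K).le))) r
end
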